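/- Let G be a (P₃∪P₂, K₄, co-domino, co-A)-free graph and let D₁ := {x ∈ V(G) : ω(G − N(x)) ≤ 2} and D₂ := V(G) \ D₁. If the induced subgraph G[D₂] is not a clique (equivalently, G[D₂] is not an induced subgraph of K₃), then χ(G) ≤ 7. -/

import Mathlib

open SimpleGraph

/-- `G` contains `H`, i.e. `H` is isomorphic to an induced subgraph of `G`. -/
def Contains {V W : Type*} (G : SimpleGraph V) (H : SimpleGraph W) : Prop :=
  Nonempty (H ↪g G)

/-- The path `P₃` on 3 vertices. -/
def P3 : SimpleGraph (Fin 3) := fromEdgeSet {s(0,1), s(1,2)}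

/-- The disjoint union `P₃ ∪ P₂` on 5 vertices. -/
def P3P2 : SimpleGraph (Fin 5) := fromEdgeSet {s(0,1), s(1,2), s(3,4)}

/-- The disjoint union `K₃ ∪ P₂` on 5 vertices. -/
def K3P2 : SimpleGraph (Fin 5) := fromEdgeSet {s(0,1), s(0,2), s(1,2), s(3,4)}

/-- co-domino: the 6-cycle u₁v₁v₂v₃u₃u₂ (vertices 0 1 2 3 4 5) plus the edges
v₁v₃ and u₁u₃. -/
def coDomino : SimpleGraph (Fin 6) :=
  fromEdgeSet {s(0,1), s(1,2), s(2,3), s(3,4), s(4,5), s(5,0), s(1,3), s(0,4)}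

/-- co-A: the 6-cycle u₁v₁v₂v₃u₃u₂ (vertices 0 1 2 3 4 5) plus the edges
v₁v₃, u₁u₃ and u₁v₃. -/
def coA : SimpleGraph (Fin 6) :=
  fromEdgeSet {s(0,1), s(1,2), s(2,3), s(3,4), s(4,5), s(5,0), s(1,3), s(0,4), s(0,3)}

/-- χ37: the 6-cycle u₁v₁v₂v₃u₃u₂ (vertices 0 1 2 3 4 5) plus the single edge v₁v₃. -/
def chi37 : SimpleGraph (Fin 6) :=
  fromEdgeSet {s(0,1), s(1,2), s(2,3), s(3,4), s(4,5), s(5,0), s(1,3)}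

/-- X₁: the 6-cycle v₁v₂v₃u₃u₂u₁ (vertices 0 1 2 3 4 5) plus the edge v₁v₃,
together with a new vertex u = 6 and the edges uv₁ and uu₂. -/
def X1 : SimpleGraph (Fin 7) :=
  fromEdgeSet {s(0,1), s(1,2), s(2,3), s(3,4), s(4,5), s(5,0), s(0,2), s(6,0), s(6,4)}

/-- X₂: the 6-cycle v₁v₂v₃u₃u₂u₁ (vertices 0 1 2 3 4 5) plus the edges v₁v₃, v₃u₁, u₁u₃,
together with a new vertex u = 6 and the edges uv₂ and uu₂. -/
def X2 : SimpleGraph (Fin 7) :=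
  fromEdgeSet {s(0,1), s(1,2), s(2,3), s(3,4), s(4,5), s(5,0), s(0,2), s(2,5), s(3,5),
    s(6,1), s(6,4)}

/-- co-twin-C₅: the 5-cycle v₁v₂v₃v₄v₅ (vertices 0 1 2 3 4) plus a new vertex v₆ = 5
adjacent exactly to v₃, v₄ and v₅. -/
def coTwinC5 : SimpleGraph (Fin 6) :=
  fromEdgeSet {s(0,1), s(1,2), s(2,3), s(3,4), s(4,0), s(2,5), s(3,5), s(4,5)}

/-- `D₁ = {x : ω(G − N(x)) ≤ 2}`, where `G − N(x)` is the subgraph induced on the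
vertices not adjacent to `x` (including `x` itself). -/
def D1 {V : Type*} (G : SimpleGraph V) : Set V :=
  {x : V | (G.induce {y : V | ¬ G.Adj x y}).cliqueNum ≤ 2}

/-- `M(v)`: the set of vertices distinct from `v` and nonadjacent to `v`. -/
def Mset {V : Type*} (G : SimpleGraph V) (v : V) : Set V :=
  {u : V | u ≠ v ∧ ¬ G.Adj v u}

namespace SimpleGraph

variable {V : Type*}

/-- A graph in which any two distinct vertices at distance two are adjacent is a disjoint union
of cliques, so it can be coloured with as many colours as its largest clique has vertices. -/
theorem colorable_of_adj_trans [Finite V] {G : SimpleGraph V} {k : ℕ}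
    (htrans : ∀ u v w, G.Adj u v → G.Adj v w → u ≠ w → G.Adj u w)
    (hk : G.CliqueFree (k + 1)) : G.Colorable k := by
  classical
  have := Fintype.ofFinite V
  let r : Setoid V :=
    { r := fun u v => u = v ∨ G.Adj u v
      iseqv :=
        { refl := fun u => Or.inl rfl
          symm := fun h => h.imp Eq.symm fun h => h.symm
          trans := by
            rintro u v w (rfl | huv) (rfl | hvw)
            · exact Or.inl rfl
            · exact Or.inr hvw
            · exact Or.inr huv
            · by_cases h : u = w
              · exact Or.inl h
              · exact Or.inr (htrans u v w huv hvw h) } }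
  have hcard : ∀ q : Quotient r,
      Fintype.card {v : V // Quotient.mk r v = q} ≤ Fintype.card (Fin k) := by
    intro q
    by_contra! hlt
    rw [Fintype.card_fin, Fintype.card_subtype] at hlt
    obtain ⟨s, hs, hsk⟩ := Finset.exists_subset_card_eq hlt
    refine hk s ⟨fun u hu v hv huv => ?_, hsk⟩
    have hu' := (Finset.mem_filter.1 (hs hu)).2
    have hv' := (Finset.mem_filter.1 (hs hv)).2
    exact (Quotient.exact (hu'.trans hv'.symm)).resolve_left huv
  have c : ∀ q : Quotient r, {v : V // Quotient.mk r v = q} ↪ Fin k := fun q =>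
    (Function.Embedding.nonempty_of_card_le (hcard q)).some
  refine ⟨Coloring.mk (fun v => c (Quotient.mk r v) ⟨v, rfl⟩) fun {u v} huv heq => ?_⟩
  have hq : Quotient.mk r u = Quotient.mk r v := Quotient.sound (Or.inr huv)
  have key : ∀ (q q' : Quotient r) (hu : Quotient.mk r u = q) (hv : Quotient.mk r v = q'),
      q = q' → c q ⟨u, hu⟩ ≠ c q' ⟨v, hv⟩ := by
    rintro q _ hu hv rfl h
    exact huv.ne (congrArg Subtype.val ((c q).injective h))
  exact key _ _ rfl rfl hq heq

theorem Colorable.of_induce_compl {G : SimpleGraph V} {s : Set V} {m n : ℕ}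
    (hs : (G.induce s).Colorable m) (hsc : (G.induce sᶜ).Colorable n) : G.Colorable (m + n) := by
  classical
  obtain ⟨c⟩ := hs
  obtain ⟨d⟩ := hsc
  have hcol : G.Coloring (Fin m ⊕ Fin n) :=
    Coloring.mk (fun v => if h : v ∈ s then Sum.inl (c ⟨v, h⟩) else Sum.inr (d ⟨v, h⟩)) <| by
      intro u v huv
      by_cases hu : u ∈ s <;> by_cases hv : v ∈ s <;>
        simp only [hu, hv, dite_true, dite_false, ne_eq, Sum.inl.injEq, Sum.inr.injEq, reduceCtorEq,
          not_false_eq_true]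
      · exact c.valid huv
      · exact d.valid huv
  simpa using hcol.colorable

end SimpleGraph

/-! ### Small graphs encoded by rows of bits -/

namespace RowGraph

variable {V : Type*}

/-- A list `g` of natural numbers encodes a graph on `{0, …, g.length - 1}`: for `j < i`, the
vertices `i` and `j` are adjacent if bit `j` of the entry `i` is set. -/
def adj (g : List ℕ) (i j : ℕ) : Bool :=
  if j < i then (g.getD i 0).testBit j else if i < j then (g.getD j 0).testBit i else false

/-- The vertices `f 0, f 1, …` of `G` induce the graph encoded by `g`. -/
def Realizes (G : SimpleGraph V) (g : List ℕ) (f : ℕ → V) : Prop :=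
  ∀ i < g.length, ∀ j < i, f i ≠ f j ∧ (G.Adj (f i) (f j) ↔ (g.getD i 0).testBit j = true)

/-- `G` has an induced subgraph isomorphic to the graph encoded by `g`. -/
def Has (G : SimpleGraph V) (g : List ℕ) : Prop := ∃ f, Realizes G g f

theorem Realizes.ne {G : SimpleGraph V} {g : List ℕ} {f : ℕ → V} (hf : Realizes G g f) {i j : ℕ}
    (hi : i < g.length) (hj : j < g.length) (hij : i ≠ j) : f i ≠ f j := by
  rcases lt_or_gt_of_ne hij with h | h
  · exact (hf j hj i h).1.symm
  · exact (hf i hi j h).1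

theorem Realizes.adj_iff {G : SimpleGraph V} {g : List ℕ} {f : ℕ → V} (hf : Realizes G g f)
    {i j : ℕ} (hi : i < g.length) (hj : j < g.length) : G.Adj (f i) (f j) ↔ adj g i j = true := by
  rcases lt_trichotomy j i with h | rfl | h
  · simpa [adj, h] using (hf i hi j h).2
  · simp [adj]
  · simpa [adj, h, h.not_gt, G.adj_comm] using (hf j hj i h).2

/-- The map `i ↦ e[i]` embeds the graph encoded by `p` into the one encoded by `g`. -/
def isEmb (p g e : List ℕ) : Bool :=
  (List.range p.length).all fun i => decide (e.getD i 0 < g.length) &&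
    (List.range i).all fun j => decide (e.getD i 0 ≠ e.getD j 0) &&
      (adj g (e.getD i 0) (e.getD j 0) == (p.getD i 0).testBit j)

theorem Has.of_isEmb {G : SimpleGraph V} {p g e : List ℕ} (he : isEmb p g e = true)
    (hg : Has G g) : Has G p := by
  obtain ⟨f, hf⟩ := hg
  simp only [isEmb, List.all_eq_true, List.mem_range, Bool.and_eq_true, decide_eq_true_eq,
    beq_iff_eq] at he
  refine ⟨fun i => f (e.getD i 0), fun i hi j hj => ?_⟩
  have hi' := (he i hi).1
  have hj' := (he j (hj.trans hi)).1
  obtain ⟨hne, hadj⟩ := (he i hi).2 j hj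
  exact ⟨hf.ne hi' hj' hne, by rw [hf.adj_iff hi' hj', hadj]⟩

theorem Realizes.snoc {G : SimpleGraph V} {g : List ℕ} {f : ℕ → V} (hf : Realizes G g f) {v : V}
    {s : ℕ} (hv : ∀ i < g.length, v ≠ f i ∧ (G.Adj v (f i) ↔ s.testBit i = true)) :
    Realizes G (g ++ [s]) (Function.update f g.length v) := by
  intro i hi j hj
  rw [List.length_append, List.length_singleton, Nat.lt_succ_iff] at hi
  have hjg : j < g.length := hj.trans_le hi
  rw [Function.update_of_ne hjg.ne]
  rcases hi.eq_or_lt with rfl | hi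
  · simpa using hv j hjg
  · rw [Function.update_of_ne hi.ne, List.getD_append _ _ _ _ hi]
    exact hf i hi j hj

/-- An embedding `i ↦ e[i]` of the `k`-th graph of a list. The test whether the bits `mask` of a
given number agree with `bits` selects, without affecting correctness, the graphs for which the
embedding is worth trying. -/
structure EmbeddingHint where
  mask : ℕ
  bits : ℕ
  k : ℕ
  e : List ℕ

/-- One of the embeddings in `hints` shows that the graph encoded by `g` contains one of `pats`. -/
def excluded (pats : List (List ℕ)) (hints : List EmbeddingHint) (key : ℕ) (g : List ℕ) : Bool :=
  hints.any fun c => Nat.beq (Nat.land key c.mask) c.bits &&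
    match pats[c.k]? with
    | some p => isEmb p g c.e
    | none => false

theorem not_has_of_excluded {G : SimpleGraph V} {pats : List (List ℕ)}
    {hints : List EmbeddingHint} {key : ℕ} {g : List ℕ} (hpats : ∀ p ∈ pats, ¬ Has G p)
    (h : excluded pats hints key g = true) : ¬ Has G g := by
  intro hg
  simp only [excluded, List.any_eq_true, Bool.and_eq_true] at h
  obtain ⟨c, -, -, hc⟩ := h
  split at hc
  · next p hp => exact hpats p (List.mem_of_getElem? hp) (hg.of_isEmb hc)
  · exact absurd hc (by simp)

/-! ### Colouring certificates -/

/-- A set of vertices specified by two adjacent vertices `a`, `b` of a small graph and possibly a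
third one `c`: the common nonneighbours of `a` and `b` (that are adjacent to `c`). -/
abbrev Block := Option (ℕ × ℕ × Option ℕ)

namespace Block

/-- Membership in a block of a vertex whose adjacency to the small graph is `s`. -/
def mem : Block → (ℕ → Bool) → Bool
  | none, _ => false
  | some (a, b, none), s => !s a && !s b
  | some (a, b, some c), s => !s a && !s b && s c

/-- An upper bound for the chromatic number of a block. -/
def size : Block → ℕ
  | none => 0
  | some (_, _, none) => 3
  | some (_, _, some _) => 2

/-- The block consists of vertices of the graph encoded by `g`, and `a`, `b` are adjacent. -/
def valid (g : List ℕ) : Block → Bool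
  | none => true
  | some (a, b, none) => decide (a < g.length) && decide (b < g.length) && adj g a b
  | some (a, b, some c) =>
    decide (a < g.length) && decide (b < g.length) && adj g a b && decide (c < g.length)

/-- The vertices of `G` in a block. -/
def toSet (G : SimpleGraph V) (f : ℕ → V) : Block → Set V
  | none => ∅
  | some (a, b, none) => {v | ¬ G.Adj v (f a) ∧ ¬ G.Adj v (f b)}
  | some (a, b, some c) => {v | ¬ G.Adj v (f a) ∧ ¬ G.Adj v (f b) ∧ G.Adj v (f c)}

end Block

/-- The graph `P₃ ∪ P₂`. -/
abbrev pathPair : List ℕ := [0, 1, 2, 0, 8]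

theorem adj_trans_of_anticomplete {G : SimpleGraph V} (hP : ¬ Has G pathPair) {a b u v w : V}
    (hab : G.Adj a b) (hua : ¬ G.Adj u a) (hub : ¬ G.Adj u b) (hva : ¬ G.Adj v a)
    (hvb : ¬ G.Adj v b) (hwa : ¬ G.Adj w a) (hwb : ¬ G.Adj w b) (huv : G.Adj u v)
    (hvw : G.Adj v w) (huw : u ≠ w) : G.Adj u w := by
  by_contra hn
  have hne : ∀ {x y z : V}, G.Adj y z → ¬ G.Adj x z → x ≠ y := by
    rintro x y z h1 h2 rfl
    exact h2 h1
  refine hP ⟨fun i => [u, v, w, a, b].getD i u, fun i hi j hj => ?_⟩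
  simp only [pathPair, List.length_cons, List.length_nil] at hi
  have := hne hab hub
  have := hne hab hvb
  have := hne hab hwb
  have := hne hab.symm hua
  have := hne hab.symm hva
  have := hne hab.symm hwa
  have := huv.ne
  have := hvw.ne
  have := hab.ne
  have := G.adj_comm
  interval_cases i <;> interval_cases j <;> simp [Nat.testBit] <;> grind

theorem Block.colorable [Finite V] {G : SimpleGraph V} (hP : ¬ Has G pathPair)
    (hK : G.CliqueFree 4) {g : List ℕ} {f : ℕ → V} (hf : Realizes G g f) {b : Block}
    (hb : b.valid g = true) : (G.induce (b.toSet G f)).Colorable b.size := by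
  match b with
  | none =>
    have : IsEmpty (Block.toSet G f none) := inferInstanceAs (IsEmpty (∅ : Set V))
    exact Colorable.of_isEmpty _
  | some (a, b, none) =>
    simp only [Block.valid, Bool.and_eq_true, decide_eq_true_eq] at hb
    have hab := (hf.adj_iff hb.1.1 hb.1.2).2 hb.2
    refine SimpleGraph.colorable_of_adj_trans ?_ ?_
    · rintro ⟨u, hu⟩ ⟨v, hv⟩ ⟨w, hw⟩ huv hvw huw
      exact adj_trans_of_anticomplete hP hab hu.1 hu.2 hv.1 hv.2 hw.1 hw.2 huv hvw
        fun h => huw (Subtype.ext h)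
    · exact hK.comap (Embedding.induce _).isContained
  | some (a, b, some c) =>
    simp only [Block.valid, Bool.and_eq_true, decide_eq_true_eq] at hb
    have hab := (hf.adj_iff hb.1.1.1 hb.1.1.2).2 hb.1.2
    refine SimpleGraph.colorable_of_adj_trans ?_ ?_
    · rintro ⟨u, hu⟩ ⟨v, hv⟩ ⟨w, hw⟩ huv hvw huw
      exact adj_trans_of_anticomplete hP hab hu.1 hu.2.1 hv.1 hv.2.1 hw.1 hw.2.1 huv hvw
        fun h => huw (Subtype.ext h)
    · classical
      intro s hs
      refine hK _ (((isNClique_induce_iff _ _ _).1 hs).insert (a := f c) fun v hv => ?_)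
      obtain ⟨w, -, rfl⟩ := Finset.mem_map.1 hv
      exact w.2.2.2.symm

/-- A certificate that a graph containing `graph`, but none of finitely many other small graphs,
is `7`-colourable. Outside `block`, each colour class is the union of a set of vertices of `graph`
and of the vertices outside `graph` whose neighbourhoods in `graph` belong to a list of bit masks.
The embeddings `typeHints` show that the other masks do not occur, and `pairHints` that vertices
outside `graph` whose masks lie in the same list are nonadjacent. -/
structure Certificate where
  graph : List ℕ
  block : Block
  classes : List (List ℕ × List ℕ)
  typeHints : List EmbeddingHint
  pairHints : List EmbeddingHint

namespace Certificate

/-- Every vertex is in the block or in a colour class. -/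
def covers (C : Certificate) (pats : List (List ℕ)) : Bool :=
  ((List.range C.graph.length).all fun h =>
    C.block.mem (adj C.graph h) || C.classes.any fun c => c.1.contains h) &&
  ((List.range (2 ^ C.graph.length)).all fun s =>
    C.block.mem s.testBit || (C.classes.any fun c => c.2.contains s) ||
      excluded pats C.typeHints s (C.graph ++ [s]))

/-- The colour class `c` is an independent set. -/
def independent (C : Certificate) (pats : List (List ℕ)) (c : List ℕ × List ℕ) : Bool :=
  (c.1.all fun h => decide (h < C.graph.length) && (c.1.all fun h' => !adj C.graph h h') &&
    c.2.all fun s => !s.testBit h) &&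
  c.2.all fun s => c.2.all fun t => decide (t < s) ||
    excluded pats C.pairHints (s + 2 ^ C.graph.length * t)
      (C.graph ++ [s] ++ [t ||| 2 ^ C.graph.length])

/-- The certificate is correct for graphs without the induced subgraphs `pats`. -/
def check (C : Certificate) (pats : List (List ℕ)) : Bool :=
  C.block.valid C.graph && decide (C.block.size + C.classes.length ≤ 7) && C.covers pats &&
    C.classes.all (C.independent pats)

/-- The set of vertices in the colour class `c`. -/
def classSet (C : Certificate) (G : SimpleGraph V) (f : ℕ → V) (c : List ℕ × List ℕ) : Set V :=
  {v | (∃ h ∈ c.1, v = f h) ∨ ∃ s ∈ c.2, s < 2 ^ C.graph.length ∧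
    ∀ i < C.graph.length, v ≠ f i ∧ (G.Adj v (f i) ↔ s.testBit i = true)}

theorem mem_block_or_classSet {C : Certificate} {pats : List (List ℕ)} {G : SimpleGraph V}
    {f : ℕ → V} (hpats : ∀ p ∈ pats, ¬ Has G p) (hf : Realizes G C.graph f)
    (hvalid : C.block.valid C.graph = true) (hC : C.covers pats = true) (v : V) :
    v ∈ C.block.toSet G f ∨ ∃ c ∈ C.classes, v ∈ C.classSet G f c := by
  have hblock : ∀ s : ℕ → Bool, (∀ i < C.graph.length, (G.Adj v (f i) ↔ s i = true)) →
      C.block.mem s = true → v ∈ C.block.toSet G f := by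
    intro s hs hmem
    match hCb : C.block with
    | none => simp [hCb, Block.mem] at hmem
    | some (a, b, none) =>
      simp only [hCb, Block.valid, Block.mem, Bool.and_eq_true, Bool.not_eq_true',
        decide_eq_true_eq] at hvalid hmem
      simp [Block.toSet, hs _ hvalid.1.1, hs _ hvalid.1.2, hmem.1, hmem.2]
    | some (a, b, some c) =>
      simp only [hCb, Block.valid, Block.mem, Bool.and_eq_true, Bool.not_eq_true',
        decide_eq_true_eq] at hvalid hmem
      simp [Block.toSet, hs _ hvalid.1.1.1, hs _ hvalid.1.1.2, hs _ hvalid.2, hmem.1.1,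
        hmem.1.2, hmem.2]
  simp only [covers, Bool.and_eq_true, List.all_eq_true, List.mem_range, Bool.or_eq_true,
    List.any_eq_true, List.contains_iff_mem] at hC
  by_cases hv : ∃ h < C.graph.length, v = f h
  · obtain ⟨h, hh, rfl⟩ := hv
    refine (hC.1 h hh).imp (hblock _ fun i hi => hf.adj_iff hh hi) ?_
    rintro ⟨c, hc, hhc⟩
    exact ⟨c, hc, Or.inl ⟨h, hhc, rfl⟩⟩
  · push Not at hv
    classical
    obtain ⟨s, hs, hsv⟩ : ∃ s < 2 ^ C.graph.length,
        ∀ i < C.graph.length, (G.Adj v (f i) ↔ s.testBit i = true) :=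
      ⟨Nat.ofBits fun i : Fin C.graph.length => decide (G.Adj v (f i)), Nat.ofBits_lt_two_pow _,
        fun i hi => by simp [Nat.testBit_ofBits_lt, hi]⟩
    rcases hC.2 s hs with (h | ⟨c, hc, hsc⟩) | h
    · exact Or.inl (hblock _ hsv h)
    · exact Or.inr ⟨c, hc, Or.inr ⟨s, hsc, hs, fun i hi => ⟨hv i hi, hsv i hi⟩⟩⟩
    · exact absurd ⟨_, hf.snoc fun i hi => ⟨hv i hi, hsv i hi⟩⟩ (not_has_of_excluded hpats h)

theorem not_adj_of_mem_classSet {C : Certificate} {pats : List (List ℕ)} {G : SimpleGraph V}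
    {f : ℕ → V} (hpats : ∀ p ∈ pats, ¬ Has G p) (hf : Realizes G C.graph f)
    {c : List ℕ × List ℕ} (hc : C.independent pats c = true) {u v : V}
    (hu : u ∈ C.classSet G f c) (hv : v ∈ C.classSet G f c) : ¬ G.Adj u v := by
  simp only [independent, Bool.and_eq_true, List.all_eq_true, Bool.or_eq_true, decide_eq_true_eq,
    Bool.not_eq_true'] at hc
  obtain ⟨hc, hpair⟩ := hc
  intro huv
  rcases hu with ⟨h, hh, rfl⟩ | ⟨s, hs, hsl, hus⟩ <;>
    rcases hv with ⟨h', hh', rfl⟩ | ⟨t, ht, htl, hvt⟩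
  · rw [hf.adj_iff (hc h hh).1.1 (hc h' hh').1.1, (hc h hh).1.2 h' hh'] at huv
    exact absurd huv (by simp)
  · rw [G.adj_comm, (hvt h (hc h hh).1.1).2, (hc h hh).2 t ht] at huv
    exact absurd huv (by simp)
  · rw [(hus h' (hc h' hh').1.1).2, (hc h' hh').2 s hs] at huv
    exact absurd huv (by simp)
  · wlog hst : s ≤ t generalizing u v s t
    · exact this huv.symm t ht htl hvt s hs hsl hus (le_of_not_ge hst)
    refine not_has_of_excluded hpats ((hpair s hs t ht).resolve_left hst.not_gt)
      ⟨_, (hf.snoc hus).snoc (v := v) fun i hi => ?_⟩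
    rw [List.length_append, List.length_singleton, Nat.lt_succ_iff] at hi
    rw [Nat.testBit_or, Nat.testBit_two_pow]
    rcases hi.eq_or_lt with rfl | hi
    · simp [huv.symm, huv.ne']
    · rw [Function.update_of_ne hi.ne]
      simpa [hi.ne'] using hvt i hi

theorem colorable [Finite V] {C : Certificate} {pats : List (List ℕ)} {G : SimpleGraph V}
    (hP : ¬ Has G pathPair) (hK : G.CliqueFree 4) (hpats : ∀ p ∈ pats, ¬ Has G p)
    (hC : C.check pats = true) (hG : Has G C.graph) : G.Colorable 7 := by
  obtain ⟨f, hf⟩ := hG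
  simp only [check, Bool.and_eq_true, decide_eq_true_eq, List.all_eq_true] at hC
  obtain ⟨⟨⟨hvalid, hsize⟩, hcovers⟩, hind⟩ := hC
  have hclass : ∀ v : ↥(C.block.toSet G f)ᶜ, ∃ i : Fin C.classes.length,
      v.1 ∈ C.classSet G f (C.classes.get i) := by
    intro v
    obtain ⟨c, hc, hv⟩ := (mem_block_or_classSet hpats hf hvalid hcovers v.1).resolve_left v.2
    obtain ⟨i, rfl⟩ := List.get_of_mem hc
    exact ⟨i, hv⟩
  choose col hcol using hclass
  have hrest : (G.induce (C.block.toSet G f)ᶜ).Colorable C.classes.length :=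
    ⟨SimpleGraph.Coloring.mk col fun {u v} huv heq =>
      not_adj_of_mem_classSet hpats hf (hind _ (List.get_mem _ _)) (hcol u) (heq ▸ hcol v) huv⟩
  exact (SimpleGraph.Colorable.of_induce_compl (Block.colorable hP hK hf hvalid) hrest).mono hsize

/-- The certificates in a list are correct, where each may use that the graphs of the previous
ones do not occur. -/
def checkAll (pats : List (List ℕ)) : List Certificate → Bool
  | [] => true
  | C :: Cs => C.check pats && checkAll (pats ++ [C.graph]) Cs

theorem not_has_of_checkAll [Finite V] {G : SimpleGraph V} (hP : ¬ Has G pathPair)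
    (hK : G.CliqueFree 4) (hG : ¬ G.Colorable 7) {Cs : List Certificate}
    {pats : List (List ℕ)} (hpats : ∀ p ∈ pats, ¬ Has G p) (hCs : checkAll pats Cs = true) :
    ∀ C ∈ Cs, ¬ Has G C.graph := by
  induction Cs generalizing pats with
  | nil => simp
  | cons C Cs ih =>
    rw [checkAll, Bool.and_eq_true] at hCs
    have hC : ¬ Has G C.graph := fun h => hG (colorable hP hK hpats hCs.1 h)
    rw [List.forall_mem_cons]
    refine ⟨hC, ih (fun p hp => ?_) hCs.2⟩
    rcases List.mem_append.1 hp with hp | hp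
    · exact hpats p hp
    · rwa [List.mem_singleton.1 hp]

end Certificate

/-- The graphs `P₃ ∪ P₂`, `K₄`, co-domino and co-A. -/
def forbidden : List (List ℕ) :=
  [pathPair, [0, 1, 3, 7], [0, 1, 2, 6, 9, 17], [0, 1, 2, 7, 9, 17]]

/-- Certificates for a sequence of graphs ending with `K₃ ∪ K₁`. -/
def certificates : List Certificate := [
  { graph := [0, 0, 1, 2, 5]
    block := some (0, 2, none)
    classes := [([0], [14, 22, 28, 30]), ([2], [11, 19, 25, 27]), ([4], [7, 13, 15])]
    typeHints := [⟨15, 1, 0, [2, 0, 5, 1, 3]⟩, ⟨30, 2, 0, [3, 1, 5, 2, 4]⟩, ⟨15, 4, 0, [0, 2, 5,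
      1, 3]⟩, ⟨27, 1, 0, [4, 0, 5, 1, 3]⟩, ⟨27, 2, 0, [3, 1, 5, 0, 4]⟩, ⟨30, 8, 0, [1, 3, 5, 2,
      4]⟩, ⟨27, 8, 0, [1, 3, 5, 0, 4]⟩, ⟨21, 21, 1, [0, 2, 4, 5]⟩]
    pairHints := [⟨330, 330, 1, [1, 3, 5, 6]⟩, ⟨759, 710, 3, [2, 5, 1, 6, 4, 0]⟩, ⟨957, 908, 3,
      [2, 5, 3, 6, 4, 0]⟩, ⟨660, 660, 1, [2, 4, 5, 6]⟩, ⟨759, 611, 3, [0, 5, 1, 6, 4, 2]⟩, ⟨957,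
      809, 3, [0, 5, 3, 6, 4, 2]⟩, ⟨561, 561, 1, [0, 4, 5, 6]⟩, ⟨165, 165, 1, [0, 2, 5, 6]⟩] },
  { graph := [0, 0, 0, 1, 3, 14, 47]
    block := none
    classes := [([1, 2, 3], [97, 112]), ([5], [5, 7, 15, 28, 30]), ([], [71, 74, 92, 94]), ([6],
      [37, 39, 47, 53, 60, 61, 62, 63]), ([4], [0, 8, 33, 41, 69, 72]), ([0], [2, 64, 66, 84]),
      ([], [10, 35, 43, 56])]
    typeHints := [⟨39, 1, 0, [1, 5, 2, 0, 7]⟩, ⟨53, 1, 0, [4, 0, 7, 2, 5]⟩, ⟨23, 4, 0, [0, 4, 1,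
      2, 7]⟩, ⟨15, 6, 0, [1, 7, 2, 0, 3]⟩, ⟨30, 12, 0, [2, 7, 3, 1, 4]⟩, ⟨53, 4, 0, [5, 2, 7, 0,
      4]⟩, ⟨53, 16, 0, [0, 4, 7, 2, 5]⟩, ⟨92, 16, 0, [2, 6, 3, 4, 7]⟩, ⟨120, 16, 4, [3, 4, 5, 7,
      6]⟩, ⟨121, 25, 3, [0, 6, 5, 3, 7, 4]⟩, ⟨53, 32, 0, [2, 5, 7, 0, 4]⟩, ⟨53, 36, 4, [2, 0, 5,
      4, 7]⟩, ⟨109, 36, 3, [5, 3, 0, 6, 2, 7]⟩, ⟨122, 50, 3, [1, 6, 3, 5, 7, 4]⟩, ⟨117, 49, 2, [0,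
      6, 2, 5, 7, 4]⟩, ⟨118, 50, 3, [1, 6, 2, 5, 7, 4]⟩, ⟨73, 73, 1, [0, 3, 6, 7]⟩, ⟨121, 81, 3,
      [0, 3, 5, 6, 7, 4]⟩, ⟨98, 98, 1, [1, 5, 6, 7]⟩, ⟨100, 100, 1, [2, 5, 6, 7]⟩, ⟨117, 113, 3,
      [6, 0, 4, 7, 5, 2]⟩, ⟨104, 104, 1, [3, 5, 6, 7]⟩]
    pairHints := [⟨8385, 8385, 1, [0, 6, 7, 8]⟩, ⟨12384, 12384, 1, [5, 6, 7, 8]⟩, ⟨10578, 0, 0,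
      [4, 1, 6, 7, 8]⟩, ⟨13416, 0, 4, [3, 7, 5, 8, 6]⟩, ⟨13545, 1153, 3, [0, 6, 5, 3, 8, 7]⟩,
      ⟨14448, 2048, 0, [4, 8, 7, 5, 6]⟩, ⟨1161, 1161, 1, [0, 3, 7, 8]⟩, ⟨12513, 0, 0, [0, 6, 5, 7,
      8]⟩, ⟨8514, 8514, 1, [1, 6, 7, 8]⟩, ⟨8772, 8772, 1, [2, 6, 7, 8]⟩, ⟨9288, 9288, 1, [3, 6, 7,
      8]⟩, ⟨4644, 4644, 1, [2, 5, 7, 8]⟩, ⟨6450, 0, 0, [4, 1, 5, 7, 8]⟩, ⟨2838, 512, 0, [2, 8, 7,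
      1, 4]⟩, ⟨3354, 1024, 0, [3, 8, 7, 1, 4]⟩, ⟨3354, 1032, 4, [3, 1, 7, 4, 8]⟩, ⟨5289, 0, 0, [0,
      3, 5, 7, 8]⟩, ⟨13158, 4354, 3, [1, 6, 2, 5, 8, 7]⟩, ⟨10836, 2048, 0, [4, 8, 7, 2, 6]⟩,
      ⟨4386, 4386, 1, [1, 5, 7, 8]⟩, ⟨8643, 0, 0, [0, 6, 1, 7, 8]⟩] },
  { graph := [0, 0, 0, 1, 3, 15, 51]
    block := none
    classes := [([0, 1], [24, 56, 72, 88, 92, 112, 116, 120, 124]), ([4, 5], [7, 10, 67, 69, 71,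
      74, 75, 78, 79]), ([6], [0, 2, 21, 30, 32, 48, 53, 62]), ([3], [33, 35, 49, 51, 55]), ([],
      [1, 3, 23, 26, 27, 64, 65]), ([], [11, 31, 58]), ([2], [34, 50, 96])]
    typeHints := [⟨23, 4, 0, [0, 4, 1, 2, 7]⟩, ⟨86, 4, 4, [1, 2, 4, 7, 6]⟩, ⟨15, 6, 0, [1, 7, 2,
      0, 3]⟩, ⟨90, 8, 4, [1, 3, 4, 7, 6]⟩, ⟨92, 12, 0, [2, 7, 3, 4, 6]⟩, ⟨60, 16, 0, [2, 5, 3, 4,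
      7]⟩, ⟨71, 4, 0, [0, 6, 1, 2, 7]⟩, ⟨91, 25, 3, [0, 6, 1, 4, 7, 3]⟩, ⟨117, 37, 3, [0, 7, 2, 5,
      6, 4]⟩, ⟨122, 42, 3, [1, 7, 3, 5, 6, 4]⟩, ⟨41, 41, 1, [0, 3, 5, 7]⟩, ⟨107, 66, 3, [5, 1, 7,
      6, 0, 3]⟩, ⟨91, 73, 3, [0, 4, 1, 6, 7, 3]⟩, ⟨121, 80, 3, [0, 4, 7, 6, 5, 3]⟩, ⟨81, 81, 1,
      [0, 4, 6, 7]⟩, ⟨82, 82, 1, [1, 4, 6, 7]⟩, ⟨97, 97, 1, [0, 5, 6, 7]⟩, ⟨98, 98, 1, [1, 5, 6,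
      7]⟩, ⟨122, 104, 3, [5, 1, 4, 6, 7, 3]⟩]
    pairHints := [⟨12900, 0, 0, [2, 5, 6, 7, 8]⟩, ⟨8643, 0, 0, [0, 6, 1, 7, 8]⟩, ⟨4515, 0, 0, [0,
      5, 1, 7, 8]⟩, ⟨11739, 10264, 5, [7, 0, 1, 8, 3, 6, 4]⟩, ⟨11610, 11288, 3, [4, 7, 3, 8, 6,
      1]⟩, ⟨11610, 9240, 2, [4, 7, 3, 8, 6, 1]⟩, ⟨11739, 10312, 5, [7, 0, 1, 8, 3, 4, 6]⟩, ⟨11610,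
      11336, 3, [6, 7, 3, 8, 4, 1]⟩, ⟨10320, 10320, 1, [4, 6, 7, 8]⟩, ⟨13416, 0, 0, [3, 5, 6, 7,
      8]⟩, ⟨10836, 4, 0, [2, 7, 8, 4, 6]⟩, ⟨15222, 8454, 5, [7, 5, 4, 8, 2, 6, 1]⟩, ⟨10965, 8837,
      3, [0, 7, 2, 8, 6, 4]⟩, ⟨10965, 8709, 2, [0, 7, 2, 8, 6, 4]⟩, ⟨15609, 8328, 5, [3, 8, 4, 5,
      7, 6, 0]⟩, ⟨6321, 0, 0, [4, 0, 5, 7, 8]⟩, ⟨11481, 9352, 3, [0, 3, 7, 8, 6, 4]⟩, ⟨8514, 8514,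
      1, [1, 6, 7, 8]⟩, ⟨8385, 8385, 1, [0, 6, 7, 8]⟩, ⟨15222, 8516, 5, [7, 5, 4, 8, 2, 1, 6]⟩,
      ⟨11094, 9028, 3, [6, 7, 2, 8, 1, 4]⟩, ⟨8901, 512, 0, [2, 8, 7, 0, 6]⟩, ⟨9030, 512, 0, [2, 8,
      7, 1, 6]⟩, ⟨9417, 0, 0, [3, 0, 6, 7, 8]⟩, ⟨13803, 4226, 5, [1, 8, 3, 6, 7, 0, 5]⟩, ⟨11094,
      2836, 3, [4, 7, 2, 8, 1, 6]⟩, ⟨9030, 4, 0, [2, 7, 8, 1, 6]⟩, ⟨2193, 2193, 1, [0, 4, 7, 8]⟩,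
      ⟨2322, 2322, 1, [1, 4, 7, 8]⟩, ⟨8901, 4, 0, [2, 7, 8, 0, 6]⟩, ⟨10965, 2708, 3, [4, 7, 2, 8,
      0, 6]⟩, ⟨4257, 4257, 1, [0, 5, 7, 8]⟩, ⟨5676, 0, 0, [2, 5, 3, 7, 8]⟩, ⟨7224, 16, 0, [4, 7,
      8, 3, 5]⟩, ⟨6708, 16, 0, [4, 7, 8, 2, 5]⟩, ⟨11610, 3338, 3, [1, 7, 3, 8, 4, 6]⟩, ⟨1419, 2,
      0, [1, 7, 8, 0, 3]⟩, ⟨2451, 0, 0, [0, 4, 1, 7, 8]⟩] },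
  { graph := [0, 0, 0, 1, 7, 25, 31]
    block := none
    classes := [([0, 1, 2], [80, 88, 112, 120]), ([5, 6], [0, 1, 17, 24, 25]), ([], [26, 28, 31,
      62]), ([3, 4], [65, 96, 97]), ([], [98, 100, 103, 110]), ([], [15, 46]), ([], [3, 5, 39])]
    typeHints := [⟨43, 2, 4, [0, 1, 3, 7, 5]⟩, ⟨45, 4, 4, [0, 2, 3, 7, 5]⟩, ⟨46, 6, 0, [1, 7, 2,
      3, 5]⟩, ⟨30, 8, 0, [1, 4, 2, 3, 7]⟩, ⟨95, 10, 5, [3, 1, 2, 0, 7, 4, 6]⟩, ⟨93, 9, 3, [0, 4,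
      2, 6, 3, 7]⟩, ⟨95, 12, 5, [3, 2, 1, 0, 7, 4, 6]⟩, ⟨91, 9, 3, [0, 4, 1, 6, 3, 7]⟩, ⟨39, 6, 0,
      [1, 7, 2, 0, 5]⟩, ⟨123, 16, 6, [6, 5, 7, 1, 3, 4, 0]⟩, ⟨59, 19, 3, [0, 7, 1, 4, 5, 3]⟩, ⟨61,
      21, 3, [0, 7, 2, 4, 5, 3]⟩, ⟨63, 27, 6, [7, 5, 2, 1, 3, 4, 0]⟩, ⟨63, 29, 6, [7, 5, 1, 2, 3,
      4, 0]⟩, ⟨102, 32, 0, [1, 6, 2, 5, 7]⟩, ⟨119, 34, 5, [5, 1, 2, 0, 7, 6, 4]⟩, ⟨117, 33, 3, [0,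
      6, 2, 4, 5, 7]⟩, ⟨119, 36, 5, [5, 2, 1, 0, 7, 6, 4]⟩, ⟨115, 33, 3, [0, 6, 1, 4, 5, 7]⟩, ⟨15,
      6, 0, [1, 7, 2, 0, 3]⟩, ⟨41, 41, 1, [0, 3, 5, 7]⟩, ⟨59, 50, 3, [4, 0, 3, 5, 7, 1]⟩, ⟨49, 49,
      1, [0, 4, 5, 7]⟩, ⟨61, 52, 3, [4, 0, 3, 5, 7, 2]⟩, ⟨63, 58, 6, [7, 0, 2, 1, 3, 4, 5]⟩, ⟨63,
      60, 6, [7, 0, 1, 2, 3, 4, 5]⟩, ⟨123, 64, 6, [4, 3, 7, 1, 5, 6, 0]⟩, ⟨107, 67, 3, [0, 7, 1,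
      6, 3, 5]⟩, ⟨109, 69, 3, [0, 7, 2, 6, 3, 5]⟩, ⟨107, 74, 3, [3, 7, 1, 6, 0, 5]⟩, ⟨73, 73, 1,
      [0, 3, 6, 7]⟩, ⟨109, 76, 3, [3, 7, 2, 6, 0, 5]⟩, ⟨81, 81, 1, [0, 4, 6, 7]⟩, ⟨111, 99, 6, [7,
      3, 2, 1, 5, 6, 0]⟩, ⟨111, 101, 6, [7, 3, 1, 2, 5, 6, 0]⟩, ⟨111, 106, 6, [7, 0, 2, 1, 5, 6,
      3]⟩, ⟨111, 108, 6, [7, 0, 1, 2, 5, 6, 3]⟩, ⟨82, 82, 1, [1, 4, 6, 7]⟩]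
    pairHints := [⟨10320, 10320, 1, [4, 6, 7, 8]⟩, ⟨9030, 0, 0, [1, 6, 2, 7, 8]⟩, ⟨2322, 2322, 1,
      [1, 4, 7, 8]⟩, ⟨12513, 0, 0, [5, 0, 6, 7, 8]⟩, ⟨2580, 2580, 1, [2, 4, 7, 8]⟩, ⟨2838, 0, 0,
      [1, 4, 2, 7, 8]⟩, ⟨8514, 8514, 1, [1, 6, 7, 8]⟩, ⟨3225, 0, 0, [3, 0, 4, 7, 8]⟩, ⟨8772, 8772,
      1, [2, 6, 7, 8]⟩, ⟨14448, 0, 0, [5, 4, 6, 7, 8]⟩, ⟨11481, 1033, 3, [0, 7, 8, 3, 6, 4]⟩,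
      ⟨5160, 5160, 1, [3, 5, 7, 8]⟩, ⟨11352, 0, 0, [3, 6, 4, 7, 8]⟩] },
  { graph := [0, 0, 0, 3, 7, 13, 23]
    block := some (3, 5, some 0)
    classes := [([0, 1, 2], [24, 72, 88, 112, 120]), ([5], [0, 29, 31, 77, 79]), ([3], [96, 98,
      99, 102, 103]), ([], [48, 50, 51, 54, 55]), ([], [6, 28, 30, 76, 78])]
    typeHints := [⟨39, 2, 0, [0, 5, 2, 1, 7]⟩, ⟨15, 4, 0, [0, 3, 1, 2, 7]⟩, ⟨120, 8, 0, [5, 3, 7,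
      4, 6]⟩, ⟨120, 16, 0, [6, 4, 7, 3, 5]⟩, ⟨93, 25, 3, [0, 6, 2, 4, 7, 3]⟩, ⟨120, 32, 0, [3, 5,
      7, 4, 6]⟩, ⟨120, 40, 4, [3, 4, 5, 6, 7]⟩, ⟨115, 49, 3, [0, 6, 1, 4, 7, 5]⟩, ⟨122, 56, 2, [1,
      3, 5, 7, 4, 6]⟩, ⟨122, 58, 3, [1, 3, 5, 7, 4, 6]⟩, ⟨120, 64, 0, [4, 6, 7, 3, 5]⟩, ⟨93, 73,
      3, [0, 4, 2, 6, 7, 3]⟩, ⟨120, 80, 4, [4, 3, 6, 5, 7]⟩, ⟨81, 81, 1, [0, 4, 6, 7]⟩, ⟨84, 84,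
      1, [2, 4, 6, 7]⟩, ⟨115, 97, 3, [0, 4, 1, 6, 7, 5]⟩, ⟨122, 104, 2, [1, 3, 5, 7, 6, 4]⟩, ⟨122,
      106, 3, [1, 3, 5, 7, 6, 4]⟩, ⟨82, 82, 1, [1, 4, 6, 7]⟩]
    pairHints := [⟨12513, 0, 0, [5, 0, 6, 7, 8]⟩, ⟨4773, 0, 0, [0, 5, 2, 7, 8]⟩, ⟨11997, 10264, 5,
      [7, 0, 2, 8, 3, 6, 4]⟩, ⟨11868, 11288, 3, [4, 7, 3, 8, 6, 2]⟩, ⟨11997, 10312, 5, [7, 0, 2,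
      8, 3, 4, 6]⟩, ⟨11868, 11336, 3, [6, 7, 3, 8, 4, 2]⟩, ⟨10320, 10320, 1, [4, 6, 7, 8]⟩,
      ⟨11997, 3712, 6, [0, 2, 7, 3, 6, 8, 4]⟩, ⟨11997, 9856, 6, [0, 2, 7, 3, 4, 8, 6]⟩, ⟨1161,
      1161, 1, [0, 3, 7, 8]⟩, ⟨3225, 0, 0, [3, 0, 4, 7, 8]⟩, ⟨14706, 12640, 3, [6, 7, 5, 8, 1,
      4]⟩, ⟨8514, 8514, 1, [1, 6, 7, 8]⟩, ⟨9417, 0, 0, [3, 0, 6, 7, 8]⟩, ⟨14706, 6448, 3, [4, 7,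
      5, 8, 1, 6]⟩, ⟨2322, 2322, 1, [1, 4, 7, 8]⟩, ⟨6321, 0, 0, [4, 0, 5, 7, 8]⟩, ⟨11223, 8724, 7,
      [2, 0, 1, 7, 6, 8, 4]⟩, ⟨4515, 256, 0, [1, 8, 7, 0, 5]⟩, ⟨4515, 2, 0, [1, 7, 8, 0, 5]⟩,
      ⟨1290, 1290, 1, [1, 3, 7, 8]⟩] },
  { graph := [0, 0, 0, 3, 7, 15, 55]
    block := none
    classes := [([0, 1, 2], [0, 24, 56, 72, 88, 112, 120]), ([5], [5, 6, 7, 16, 17, 18, 19, 23]),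
      ([4], [12, 67, 71, 77, 78, 79]), ([3, 6], [37, 39, 49, 51, 53, 54, 55]), ([], [28, 38, 48,
      50]), ([], [15, 29, 30, 31, 60]), ([], [64, 65, 66, 76, 96])]
    typeHints := [⟨125, 1, 6, [5, 4, 7, 3, 2, 0, 6]⟩, ⟨126, 2, 6, [5, 4, 7, 3, 2, 1, 6]⟩, ⟨15, 4,
      0, [0, 3, 1, 2, 7]⟩, ⟨92, 8, 4, [2, 3, 4, 7, 6]⟩, ⟨95, 13, 8, [0, 1, 2, 3, 4, 7, 6]⟩, ⟨95,
      14, 8, [1, 0, 2, 3, 4, 7, 6]⟩, ⟨62, 20, 2, [1, 4, 7, 2, 5, 3]⟩, ⟨61, 20, 2, [0, 4, 7, 2, 5,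
      3]⟩, ⟨93, 25, 3, [0, 6, 2, 4, 7, 3]⟩, ⟨94, 26, 3, [1, 6, 2, 4, 7, 3]⟩, ⟨125, 32, 6, [0, 2,
      7, 3, 4, 5, 6]⟩, ⟨125, 33, 7, [6, 3, 7, 2, 0, 4, 5]⟩, ⟨124, 44, 3, [2, 7, 3, 5, 6, 4]⟩, ⟨41,
      41, 1, [0, 3, 5, 7]⟩, ⟨42, 42, 1, [1, 3, 5, 7]⟩, ⟨110, 68, 3, [5, 2, 7, 6, 1, 3]⟩, ⟨109, 68,
      3, [5, 2, 7, 6, 0, 3]⟩, ⟨93, 73, 3, [0, 4, 2, 6, 7, 3]⟩, ⟨94, 74, 3, [1, 4, 2, 6, 7, 3]⟩,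
      ⟨121, 80, 3, [0, 4, 7, 6, 5, 3]⟩, ⟨81, 81, 1, [0, 4, 6, 7]⟩, ⟨82, 82, 1, [1, 4, 6, 7]⟩, ⟨84,
      84, 1, [2, 4, 6, 7]⟩, ⟨97, 97, 1, [0, 5, 6, 7]⟩, ⟨98, 98, 1, [1, 5, 6, 7]⟩, ⟨124, 104, 3,
      [5, 2, 4, 6, 7, 3]⟩, ⟨100, 100, 1, [2, 5, 6, 7]⟩]
    pairHints := [⟨13416, 0, 0, [3, 5, 6, 7, 8]⟩, ⟨4515, 0, 0, [0, 5, 1, 7, 8]⟩, ⟨8643, 0, 0, [0,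
      6, 1, 7, 8]⟩, ⟨1419, 0, 0, [0, 3, 1, 7, 8]⟩, ⟨15996, 15360, 6, [5, 4, 7, 3, 2, 8, 6]⟩,
      ⟨11997, 10264, 5, [7, 0, 2, 8, 3, 6, 4]⟩, ⟨11868, 11288, 3, [4, 7, 3, 8, 6, 2]⟩, ⟨11868,
      9240, 2, [4, 7, 3, 8, 6, 2]⟩, ⟨11997, 10312, 5, [7, 0, 2, 8, 3, 4, 6]⟩, ⟨11868, 11336, 3,
      [6, 7, 3, 8, 4, 2]⟩, ⟨10320, 10320, 1, [4, 6, 7, 8]⟩, ⟨15609, 8328, 5, [3, 8, 4, 5, 7, 6,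
      0]⟩, ⟨6450, 0, 0, [4, 1, 5, 7, 8]⟩, ⟨6321, 0, 0, [4, 0, 5, 7, 8]⟩, ⟨11481, 9352, 3, [0, 3,
      7, 8, 6, 4]⟩, ⟨8385, 8385, 1, [0, 6, 7, 8]⟩, ⟨8514, 8514, 1, [1, 6, 7, 8]⟩, ⟨8772, 8772, 1,
      [2, 6, 7, 8]⟩, ⟨4257, 4257, 1, [0, 5, 7, 8]⟩, ⟨4644, 4644, 1, [2, 5, 7, 8]⟩, ⟨3999, 2833, 5,
      [0, 1, 2, 7, 3, 8, 4]⟩, ⟨2322, 2322, 1, [1, 4, 7, 8]⟩, ⟨13029, 4612, 3, [2, 6, 0, 5, 8, 7]⟩,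
      ⟨13287, 4356, 5, [8, 2, 0, 1, 7, 6, 5]⟩, ⟨9417, 0, 0, [3, 0, 6, 7, 8]⟩, ⟨1161, 1161, 1, [0,
      3, 7, 8]⟩, ⟨13545, 1033, 3, [0, 7, 8, 3, 5, 6]⟩, ⟨11868, 3596, 3, [2, 7, 3, 8, 4, 6]⟩,
      ⟨2580, 2580, 1, [2, 4, 7, 8]⟩, ⟨5676, 0, 0, [2, 5, 3, 7, 8]⟩, ⟨2838, 0, 0, [1, 4, 2, 7, 8]⟩,
      ⟨2709, 0, 0, [0, 4, 2, 7, 8]⟩, ⟨2451, 0, 0, [0, 4, 1, 7, 8]⟩] },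
  { graph := [0, 0, 0, 3, 7, 27, 31]
    block := none
    classes := [([0, 1], [8, 32, 72, 88, 104, 108, 120]), ([2, 3], [0, 19, 48, 112]), ([5, 6], [1,
      2, 3, 7, 13, 14, 15, 25, 27]), ([], [37, 38, 39, 44, 56, 60]), ([4], [96, 97]), ([], [67,
      98, 99]), ([], [24, 26])]
    typeHints := [⟨15, 4, 0, [0, 3, 1, 2, 7]⟩, ⟨46, 4, 4, [1, 2, 3, 7, 5]⟩, ⟨45, 4, 4, [0, 2, 3,
      7, 5]⟩, ⟨93, 9, 3, [0, 4, 2, 6, 3, 7]⟩, ⟨94, 10, 3, [1, 4, 2, 6, 3, 7]⟩, ⟨39, 4, 0, [0, 5,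
      1, 2, 7]⟩, ⟨125, 16, 6, [6, 5, 7, 2, 3, 4, 0]⟩, ⟨63, 17, 6, [0, 1, 2, 7, 3, 4, 5]⟩, ⟨61, 21,
      3, [0, 7, 2, 4, 5, 3]⟩, ⟨125, 29, 9, [6, 7, 5, 2, 3, 4, 0]⟩, ⟨126, 30, 9, [6, 7, 5, 2, 3, 4,
      1]⟩, ⟨117, 33, 3, [0, 6, 2, 4, 5, 7]⟩, ⟨118, 34, 3, [1, 6, 2, 4, 5, 7]⟩, ⟨124, 40, 2, [3, 6,
      2, 4, 5, 7]⟩, ⟨41, 41, 1, [0, 3, 5, 7]⟩, ⟨42, 42, 1, [1, 3, 5, 7]⟩, ⟨49, 49, 1, [0, 4, 5,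
      7]⟩, ⟨50, 50, 1, [1, 4, 5, 7]⟩, ⟨125, 64, 6, [4, 3, 7, 2, 5, 6, 0]⟩, ⟨111, 65, 6, [0, 1, 2,
      7, 5, 6, 3]⟩, ⟨119, 71, 9, [0, 1, 2, 5, 7, 4, 6]⟩, ⟨73, 73, 1, [0, 3, 6, 7]⟩, ⟨74, 74, 1,
      [1, 3, 6, 7]⟩, ⟨125, 80, 7, [0, 2, 7, 3, 4, 5, 6]⟩, ⟨81, 81, 1, [0, 4, 6, 7]⟩, ⟨125, 101, 9,
      [4, 7, 3, 2, 5, 6, 0]⟩, ⟨126, 102, 9, [4, 7, 3, 2, 5, 6, 1]⟩, ⟨84, 84, 1, [2, 4, 6, 7]⟩]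
    pairHints := [⟨14448, 0, 0, [5, 4, 6, 7, 8]⟩, ⟨2451, 0, 0, [0, 4, 1, 7, 8]⟩, ⟨4515, 0, 0, [0,
      5, 1, 7, 8]⟩, ⟨11868, 11272, 3, [6, 3, 7, 8, 4, 2]⟩, ⟨15093, 10272, 5, [5, 8, 2, 0, 7, 6,
      4]⟩, ⟨14964, 14368, 3, [4, 5, 7, 8, 6, 2]⟩, ⟨9288, 9288, 1, [3, 6, 7, 8]⟩, ⟨9804, 0, 0, [2,
      6, 3, 7, 8]⟩, ⟨1419, 0, 0, [0, 3, 1, 7, 8]⟩, ⟨7611, 6163, 9, [0, 1, 8, 3, 7, 5, 4]⟩, ⟨10965,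
      2177, 3, [0, 6, 2, 4, 8, 7]⟩, ⟨11223, 2178, 5, [8, 1, 2, 0, 7, 6, 4]⟩, ⟨11094, 2306, 3, [1,
      6, 2, 4, 8, 7]⟩, ⟨14061, 1157, 5, [7, 6, 5, 8, 2, 3, 0]⟩, ⟨1161, 1161, 1, [0, 3, 7, 8]⟩,
      ⟨15093, 2180, 5, [2, 8, 5, 6, 7, 0, 4]⟩, ⟨11352, 0, 0, [3, 6, 4, 7, 8]⟩, ⟨13674, 5152, 3,
      [3, 8, 7, 5, 1, 6]⟩, ⟨13545, 5152, 3, [3, 8, 7, 5, 0, 6]⟩, ⟨13803, 5155, 9, [0, 1, 8, 6, 7,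
      3, 5]⟩, ⟨8643, 0, 0, [0, 6, 1, 7, 8]⟩, ⟨2838, 0, 0, [1, 4, 2, 7, 8]⟩, ⟨8514, 8514, 1, [1, 6,
      7, 8]⟩, ⟨8901, 0, 0, [0, 6, 2, 7, 8]⟩] },
  { graph := [0, 0, 0, 3, 7, 29, 31]
    block := none
    classes := [([5, 6], [3, 6, 12, 14, 15, 29, 30, 31]), ([4], [5, 34, 38, 39, 46, 99, 102, 103,
      108]), ([0], [0, 8, 16, 24, 28, 32, 40, 48, 56, 58]), ([2], [1, 64, 72, 96, 98, 104]), ([3],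
      [7, 17, 19, 35, 65]), ([], [50, 80, 88, 112, 120]), ([1], [13, 69, 76])]
    typeHints := [⟨39, 2, 0, [0, 5, 2, 1, 7]⟩, ⟨15, 4, 0, [0, 3, 1, 2, 7]⟩, ⟨61, 9, 3, [0, 4, 2,
      5, 3, 7]⟩, ⟨94, 20, 3, [4, 1, 3, 6, 2, 7]⟩, ⟨61, 20, 3, [4, 0, 3, 5, 2, 7]⟩, ⟨95, 23, 9, [0,
      1, 2, 3, 7, 6, 4]⟩, ⟨125, 25, 9, [5, 6, 7, 2, 3, 4, 0]⟩, ⟨115, 33, 3, [0, 6, 1, 4, 5, 7]⟩,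
      ⟨94, 10, 3, [1, 4, 2, 6, 3, 7]⟩, ⟨118, 36, 3, [2, 6, 1, 4, 5, 7]⟩, ⟨41, 41, 1, [0, 3, 5,
      7]⟩, ⟨49, 49, 1, [0, 4, 5, 7]⟩, ⟨52, 52, 1, [2, 4, 5, 7]⟩, ⟨123, 67, 9, [3, 4, 7, 5, 1, 0,
      6]⟩, ⟨115, 66, 3, [4, 1, 7, 6, 0, 5]⟩, ⟨73, 73, 1, [0, 3, 6, 7]⟩, ⟨81, 81, 1, [0, 4, 6, 7]⟩,
      ⟨84, 84, 1, [2, 4, 6, 7]⟩, ⟨123, 97, 9, [3, 4, 7, 1, 5, 6, 0]⟩, ⟨74, 74, 1, [1, 3, 6, 7]⟩,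
      ⟨82, 82, 1, [1, 4, 6, 7]⟩]
    pairHints := [⟨14448, 0, 0, [5, 4, 6, 7, 8]⟩, ⟨15222, 2562, 5, [1, 8, 5, 6, 7, 2, 4]⟩, ⟨6966,
      2818, 3, [4, 1, 7, 8, 2, 5]⟩, ⟨14835, 2178, 5, [1, 8, 5, 6, 7, 0, 4]⟩, ⟨12513, 0, 0, [5, 0,
      6, 7, 8]⟩, ⟨6579, 2434, 3, [4, 1, 7, 8, 0, 5]⟩, ⟨11094, 2564, 3, [2, 6, 1, 4, 8, 7]⟩,
      ⟨11739, 3464, 10, [0, 1, 7, 4, 3, 6, 8]⟩, ⟨1161, 1161, 1, [0, 3, 7, 8]⟩, ⟨1290, 1290, 1, [1,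
      3, 7, 8]⟩, ⟨2580, 2580, 1, [2, 4, 7, 8]⟩, ⟨11352, 0, 0, [3, 6, 4, 7, 8]⟩, ⟨11223, 773, 8,
      [2, 0, 1, 7, 4, 8, 6]⟩, ⟨12126, 8452, 5, [2, 8, 3, 4, 7, 1, 6]⟩, ⟨10062, 8964, 3, [6, 2, 7,
      8, 1, 3]⟩, ⟨11094, 8708, 3, [2, 4, 1, 6, 8, 7]⟩, ⟨13545, 5152, 3, [3, 8, 7, 5, 0, 6]⟩,
      ⟨11094, 8450, 3, [1, 4, 2, 6, 8, 7]⟩, ⟨3225, 0, 0, [3, 0, 4, 7, 8]⟩, ⟨15093, 12960, 10, [0,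
      2, 7, 4, 8, 6, 5]⟩, ⟨11223, 8706, 5, [8, 1, 0, 2, 7, 4, 6]⟩, ⟨11997, 8324, 5, [2, 8, 3, 4,
      7, 0, 6]⟩, ⟨4644, 4644, 1, [2, 5, 7, 8]⟩, ⟨4257, 4257, 1, [0, 5, 7, 8]⟩, ⟨11739, 8586, 9,
      [3, 8, 4, 7, 0, 1, 6]⟩, ⟨8514, 8514, 1, [1, 6, 7, 8]⟩, ⟨14190, 13922, 9, [3, 7, 2, 1, 5, 6,
      8]⟩, ⟨8901, 0, 0, [0, 6, 2, 7, 8]⟩, ⟨8643, 0, 0, [0, 6, 1, 7, 8]⟩, ⟨7998, 7452, 9, [5, 7, 1,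
      2, 3, 4, 8]⟩, ⟨2838, 0, 0, [1, 4, 2, 7, 8]⟩, ⟨11223, 8449, 5, [8, 0, 2, 1, 7, 4, 6]⟩, ⟨2709,
      0, 0, [0, 4, 2, 7, 8]⟩, ⟨13416, 0, 0, [5, 3, 6, 7, 8]⟩, ⟨7224, 0, 0, [3, 5, 4, 7, 8]⟩,
      ⟨9804, 0, 0, [2, 6, 3, 7, 8]⟩, ⟨5676, 0, 0, [2, 5, 3, 7, 8]⟩, ⟨6837, 161, 3, [0, 4, 2, 5, 7,
      8]⟩, ⟨11481, 10256, 3, [4, 0, 3, 6, 8, 7]⟩, ⟨11739, 11282, 9, [1, 8, 0, 7, 3, 4, 6]⟩,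
      ⟨10320, 10320, 1, [4, 6, 7, 8]⟩, ⟨6450, 0, 0, [1, 4, 5, 7, 8]⟩] },
  { graph := [0, 0, 0, 3, 7, 31, 31]
    block := none
    classes := [([0, 1], [8, 12, 16, 24, 28, 32, 64, 120]), ([5, 6], [1, 2, 3, 5, 6, 7, 15, 31]),
      ([2, 3], [19, 97, 99]), ([], [0, 96, 101, 102, 112]), ([4], [103, 108]), ([], [98, 104])]
    typeHints := [⟨15, 4, 0, [0, 3, 1, 2, 7]⟩, ⟨61, 9, 3, [0, 4, 2, 5, 3, 7]⟩, ⟨94, 10, 3, [1, 4,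
      2, 6, 3, 7]⟩, ⟨123, 9, 10, [5, 6, 7, 1, 0, 4, 3]⟩, ⟨123, 10, 10, [5, 6, 7, 0, 1, 4, 3]⟩,
      ⟨123, 17, 10, [5, 6, 7, 1, 0, 3, 4]⟩, ⟨123, 18, 10, [5, 6, 7, 0, 1, 3, 4]⟩, ⟨63, 23, 9, [0,
      1, 2, 3, 7, 5, 4]⟩, ⟨125, 25, 9, [5, 6, 7, 2, 3, 4, 0]⟩, ⟨126, 26, 9, [5, 6, 7, 2, 3, 4,
      1]⟩, ⟨63, 29, 11, [0, 1, 2, 3, 4, 7, 5]⟩, ⟨63, 30, 11, [1, 0, 2, 3, 4, 7, 5]⟩, ⟨123, 33, 10,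
      [3, 4, 7, 1, 0, 6, 5]⟩, ⟨123, 34, 10, [3, 4, 7, 0, 1, 6, 5]⟩, ⟨119, 35, 9, [0, 1, 2, 7, 6,
      5, 4]⟩, ⟨125, 37, 11, [4, 3, 7, 6, 5, 2, 0]⟩, ⟨123, 40, 10, [0, 1, 7, 4, 3, 6, 5]⟩, ⟨41, 41,
      1, [0, 3, 5, 7]⟩, ⟨42, 42, 1, [1, 3, 5, 7]⟩, ⟨123, 48, 10, [0, 1, 7, 3, 4, 6, 5]⟩, ⟨49, 49,
      1, [0, 4, 5, 7]⟩, ⟨50, 50, 1, [1, 4, 5, 7]⟩, ⟨125, 56, 11, [0, 2, 7, 6, 5, 3, 4]⟩, ⟨52, 52,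
      1, [2, 4, 5, 7]⟩, ⟨123, 65, 10, [3, 4, 7, 1, 0, 5, 6]⟩, ⟨123, 66, 10, [3, 4, 7, 0, 1, 5,
      6]⟩, ⟨119, 67, 9, [0, 1, 2, 7, 5, 6, 4]⟩, ⟨125, 69, 11, [4, 3, 7, 5, 6, 2, 0]⟩, ⟨123, 72,
      10, [0, 1, 7, 4, 3, 5, 6]⟩, ⟨74, 74, 1, [1, 3, 6, 7]⟩, ⟨73, 73, 1, [0, 3, 6, 7]⟩, ⟨123, 80,
      10, [0, 1, 7, 3, 4, 5, 6]⟩, ⟨81, 81, 1, [0, 4, 6, 7]⟩, ⟨82, 82, 1, [1, 4, 6, 7]⟩, ⟨125, 88,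
      11, [0, 2, 7, 5, 6, 3, 4]⟩, ⟨84, 84, 1, [2, 4, 6, 7]⟩]
    pairHints := [⟨14448, 0, 0, [5, 4, 6, 7, 8]⟩, ⟨4515, 0, 0, [0, 5, 1, 7, 8]⟩, ⟨2451, 0, 0, [0,
      4, 1, 7, 8]⟩, ⟨15609, 15368, 10, [5, 6, 7, 0, 8, 4, 3]⟩, ⟨1419, 0, 0, [0, 3, 1, 7, 8]⟩,
      ⟨15609, 15376, 10, [5, 6, 7, 0, 8, 3, 4]⟩, ⟨8643, 0, 0, [0, 6, 1, 7, 8]⟩, ⟨15996, 15384, 9,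
      [5, 6, 7, 2, 3, 4, 8]⟩, ⟨7869, 7196, 11, [8, 0, 2, 3, 4, 7, 5]⟩, ⟨15609, 15392, 10, [3, 4,
      7, 0, 8, 6, 5]⟩, ⟨15609, 15424, 10, [3, 4, 7, 0, 8, 5, 6]⟩, ⟨5160, 5160, 1, [3, 5, 7, 8]⟩,
      ⟨7611, 3457, 10, [3, 4, 7, 1, 0, 5, 8]⟩, ⟨7611, 3458, 10, [3, 4, 7, 0, 1, 5, 8]⟩, ⟨7095,
      2947, 9, [0, 1, 2, 7, 5, 8, 4]⟩, ⟨7869, 3717, 11, [4, 3, 7, 5, 8, 2, 0]⟩, ⟨1161, 1161, 1,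
      [0, 3, 7, 8]⟩, ⟨5676, 0, 0, [2, 5, 3, 7, 8]⟩, ⟨15093, 12433, 9, [5, 6, 7, 2, 8, 4, 0]⟩,
      ⟨4257, 4257, 1, [0, 5, 7, 8]⟩, ⟨1806, 512, 0, [2, 8, 7, 1, 3]⟩, ⟨3225, 0, 0, [3, 0, 4, 7,
      8]⟩, ⟨4644, 4644, 1, [2, 5, 7, 8]⟩, ⟨1806, 4, 0, [2, 7, 8, 1, 3]⟩, ⟨1677, 4, 0, [2, 7, 8, 0,
      3]⟩, ⟨2709, 0, 0, [0, 4, 2, 7, 8]⟩] },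
  { graph := [0, 0, 0, 7, 7, 15, 23]
    block := some (3, 5, some 0)
    classes := [([0, 1, 2], [56, 88, 104, 112, 120]), ([3], [0, 2, 4, 6, 48, 52, 96, 100]), ([5],
      [24, 28, 72, 76]), ([], [25, 27, 29, 31, 49, 51, 53, 55, 73, 75, 77, 79, 97, 99, 101, 103]),
      ([], [26, 30, 50, 54, 74, 78, 98, 102])]
    typeHints := [⟨120, 8, 0, [5, 3, 7, 4, 6]⟩, ⟨120, 16, 0, [6, 4, 7, 3, 5]⟩, ⟨120, 32, 0, [3, 5,
      7, 4, 6]⟩, ⟨120, 40, 4, [3, 4, 5, 6, 7]⟩, ⟨41, 41, 1, [0, 3, 5, 7]⟩, ⟨42, 42, 1, [1, 3, 5,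
      7]⟩, ⟨44, 44, 1, [2, 3, 5, 7]⟩, ⟨120, 64, 0, [4, 6, 7, 3, 5]⟩, ⟨120, 80, 4, [4, 3, 6, 5,
      7]⟩, ⟨81, 81, 1, [0, 4, 6, 7]⟩, ⟨82, 82, 1, [1, 4, 6, 7]⟩, ⟨84, 84, 1, [2, 4, 6, 7]⟩]
    pairHints := [⟨8643, 0, 0, [0, 6, 1, 7, 8]⟩, ⟨15480, 11320, 3, [7, 4, 6, 8, 3, 5]⟩, ⟨5160,
      5160, 1, [3, 5, 7, 8]⟩, ⟨15480, 14392, 3, [7, 4, 6, 8, 5, 3]⟩, ⟨4515, 0, 0, [0, 5, 1, 7,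
      8]⟩, ⟨15480, 13400, 3, [7, 3, 5, 8, 6, 4]⟩, ⟨10320, 10320, 1, [4, 6, 7, 8]⟩, ⟨15480, 14440,
      3, [7, 6, 4, 8, 5, 3]⟩, ⟨3225, 0, 0, [3, 0, 4, 7, 8]⟩, ⟨9417, 0, 0, [3, 0, 6, 7, 8]⟩, ⟨1419,
      0, 0, [0, 3, 1, 7, 8]⟩, ⟨1161, 1161, 1, [0, 3, 7, 8]⟩, ⟨2193, 2193, 1, [0, 4, 7, 8]⟩,
      ⟨11223, 8337, 7, [0, 1, 2, 7, 6, 8, 4]⟩, ⟨13803, 12681, 11, [5, 6, 7, 1, 0, 3, 8]⟩, ⟨14061,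
      12937, 11, [5, 6, 7, 2, 0, 3, 8]⟩, ⟨7611, 4251, 11, [3, 4, 8, 1, 0, 5, 7]⟩, ⟨11223, 8595,
      10, [0, 1, 2, 7, 6, 8, 4]⟩, ⟨7869, 4253, 11, [3, 4, 8, 2, 0, 5, 7]⟩, ⟨11223, 8853, 10, [0,
      2, 1, 7, 6, 8, 4]⟩, ⟨7998, 4894, 12, [3, 8, 4, 5, 7, 1, 2]⟩, ⟨13803, 9633, 11, [3, 6, 7, 1,
      0, 5, 8]⟩, ⟨14061, 9889, 11, [3, 6, 7, 2, 0, 5, 8]⟩, ⟨4257, 4257, 1, [0, 5, 7, 8]⟩, ⟨14835,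
      8371, 11, [4, 5, 8, 1, 0, 6, 7]⟩, ⟨15093, 8373, 11, [4, 5, 8, 2, 0, 6, 7]⟩, ⟨14190, 10022,
      12, [3, 7, 6, 5, 8, 1, 2]⟩, ⟨8385, 8385, 1, [0, 6, 7, 8]⟩, ⟨1290, 1290, 1, [1, 3, 7, 8]⟩,
      ⟨2322, 2322, 1, [1, 4, 7, 8]⟩, ⟨11223, 8466, 7, [1, 0, 2, 7, 6, 8, 4]⟩, ⟨14190, 13066, 11,
      [5, 6, 7, 2, 1, 3, 8]⟩, ⟨7998, 4382, 11, [3, 4, 8, 2, 1, 5, 7]⟩, ⟨14190, 10018, 11, [3, 6,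
      7, 2, 1, 5, 8]⟩, ⟨4386, 4386, 1, [1, 5, 7, 8]⟩, ⟨15222, 8502, 11, [4, 5, 8, 2, 1, 6, 7]⟩,
      ⟨8514, 8514, 1, [1, 6, 7, 8]⟩] },
  { graph := [0, 0, 0, 7, 7, 31, 31]
    block := none
    classes := [([0, 1, 2], [8, 16, 24, 32, 64, 120]), ([5, 6], [1, 2, 3, 4, 5, 6, 7, 31]), ([3,
      4], [96, 103]), ([], [0])]
    typeHints := [⟨123, 9, 10, [5, 6, 7, 1, 0, 4, 3]⟩, ⟨123, 10, 10, [5, 6, 7, 0, 1, 4, 3]⟩, ⟨63,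
      11, 9, [0, 1, 2, 7, 4, 3, 5]⟩, ⟨125, 12, 10, [5, 6, 7, 0, 2, 4, 3]⟩, ⟨123, 11, 12, [5, 6, 7,
      4, 3, 0, 1]⟩, ⟨123, 17, 10, [5, 6, 7, 1, 0, 3, 4]⟩, ⟨123, 18, 10, [5, 6, 7, 0, 1, 3, 4]⟩,
      ⟨63, 19, 9, [0, 1, 2, 7, 3, 4, 5]⟩, ⟨125, 20, 10, [5, 6, 7, 0, 2, 3, 4]⟩, ⟨123, 19, 12, [5,
      6, 7, 3, 4, 0, 1]⟩, ⟨123, 25, 12, [5, 6, 7, 1, 0, 3, 4]⟩, ⟨123, 26, 12, [5, 6, 7, 0, 1, 3,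
      4]⟩, ⟨63, 27, 12, [0, 1, 2, 7, 5, 3, 4]⟩, ⟨125, 28, 12, [5, 6, 7, 0, 2, 3, 4]⟩, ⟨123, 33,
      10, [3, 4, 7, 1, 0, 6, 5]⟩, ⟨123, 34, 10, [3, 4, 7, 0, 1, 6, 5]⟩, ⟨111, 35, 9, [0, 1, 2, 7,
      6, 5, 3]⟩, ⟨125, 36, 10, [3, 4, 7, 0, 2, 6, 5]⟩, ⟨123, 35, 12, [3, 4, 7, 6, 5, 0, 1]⟩, ⟨123,
      40, 10, [0, 1, 7, 4, 3, 6, 5]⟩, ⟨41, 41, 1, [0, 3, 5, 7]⟩, ⟨42, 42, 1, [1, 3, 5, 7]⟩, ⟨123,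
      48, 10, [0, 1, 7, 3, 4, 6, 5]⟩, ⟨49, 49, 1, [0, 4, 5, 7]⟩, ⟨50, 50, 1, [1, 4, 5, 7]⟩, ⟨123,
      56, 12, [0, 1, 7, 6, 5, 3, 4]⟩, ⟨123, 65, 10, [3, 4, 7, 1, 0, 5, 6]⟩, ⟨123, 66, 10, [3, 4,
      7, 0, 1, 5, 6]⟩, ⟨123, 67, 12, [3, 4, 7, 5, 6, 0, 1]⟩, ⟨125, 68, 10, [3, 4, 7, 0, 2, 5, 6]⟩,
      ⟨123, 72, 10, [0, 1, 7, 4, 3, 5, 6]⟩, ⟨73, 73, 1, [0, 3, 6, 7]⟩, ⟨74, 74, 1, [1, 3, 6, 7]⟩,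
      ⟨123, 80, 10, [0, 1, 7, 3, 4, 5, 6]⟩, ⟨81, 81, 1, [0, 4, 6, 7]⟩, ⟨82, 82, 1, [1, 4, 6, 7]⟩,
      ⟨123, 88, 12, [0, 1, 7, 5, 6, 3, 4]⟩, ⟨123, 97, 12, [3, 4, 7, 1, 0, 5, 6]⟩, ⟨123, 98, 12,
      [3, 4, 7, 0, 1, 5, 6]⟩, ⟨111, 99, 12, [0, 1, 2, 7, 3, 5, 6]⟩, ⟨125, 100, 12, [3, 4, 7, 0, 2,
      5, 6]⟩, ⟨123, 104, 12, [0, 1, 7, 4, 3, 5, 6]⟩, ⟨123, 112, 12, [0, 1, 7, 3, 4, 5, 6]⟩, ⟨44,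
      44, 1, [2, 3, 5, 7]⟩]
    pairHints := [⟨14448, 0, 0, [5, 4, 6, 7, 8]⟩, ⟨4515, 0, 0, [0, 5, 1, 7, 8]⟩, ⟨2451, 0, 0, [0,
      4, 1, 7, 8]⟩, ⟨15609, 15368, 10, [5, 6, 7, 0, 8, 4, 3]⟩, ⟨8643, 0, 0, [0, 6, 1, 7, 8]⟩,
      ⟨15609, 15376, 10, [5, 6, 7, 0, 8, 3, 4]⟩, ⟨15609, 15384, 12, [5, 6, 7, 0, 8, 3, 4]⟩,
      ⟨15609, 15392, 10, [3, 4, 7, 0, 8, 6, 5]⟩, ⟨15609, 15424, 10, [3, 4, 7, 0, 8, 5, 6]⟩, ⟨5160,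
      5160, 1, [3, 5, 7, 8]⟩, ⟨7611, 3457, 10, [3, 4, 7, 1, 0, 5, 8]⟩, ⟨7611, 3458, 10, [3, 4, 7,
      0, 1, 5, 8]⟩, ⟨7611, 3459, 12, [3, 4, 7, 5, 8, 0, 1]⟩, ⟨7869, 3716, 10, [3, 4, 7, 0, 2, 5,
      8]⟩, ⟨1161, 1161, 1, [0, 3, 7, 8]⟩, ⟨13803, 12768, 12, [0, 1, 7, 3, 8, 5, 6]⟩, ⟨4257, 4257,
      1, [0, 5, 7, 8]⟩] },
  { graph := [0, 0, 1, 3, 6, 15, 27]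
    block := none
    classes := [([3], [0, 3, 7, 19]), ([0, 1], [96, 100, 112]), ([4], [12, 14, 71, 102]), ([2],
      [24, 25, 65, 113]), ([6], [34, 51, 56]), ([5], [8, 28, 76])]
    typeHints := [⟨111, 1, 6, [5, 6, 7, 2, 1, 0, 3]⟩, ⟨123, 2, 6, [6, 5, 7, 4, 0, 1, 3]⟩, ⟨78, 4,
      4, [1, 2, 3, 7, 6]⟩, ⟨91, 9, 3, [3, 1, 4, 6, 0, 7]⟩, ⟨47, 10, 3, [3, 0, 2, 5, 1, 7]⟩, ⟨125,
      9, 5, [2, 6, 7, 5, 4, 3, 0]⟩, ⟨111, 15, 9, [5, 7, 6, 2, 1, 0, 3]⟩, ⟨57, 16, 4, [0, 4, 3, 7,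
      5]⟩, ⟨61, 21, 3, [0, 7, 4, 2, 5, 3]⟩, ⟨123, 27, 9, [6, 7, 5, 4, 0, 1, 3]⟩, ⟨79, 13, 3, [0,
      6, 1, 3, 7, 2]⟩, ⟨59, 26, 3, [1, 5, 0, 3, 7, 4]⟩, ⟨111, 32, 6, [0, 1, 7, 2, 6, 5, 3]⟩, ⟨63,
      33, 5, [1, 2, 7, 3, 4, 0, 5]⟩, ⟨125, 33, 5, [6, 2, 7, 3, 4, 5, 0]⟩, ⟨110, 38, 3, [1, 7, 2,
      5, 3, 6]⟩, ⟨122, 40, 3, [1, 5, 7, 3, 6, 4]⟩, ⟨42, 42, 1, [1, 3, 5, 7]⟩, ⟨111, 33, 7, [3, 2,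
      7, 1, 0, 6, 5]⟩, ⟨59, 50, 3, [1, 3, 0, 5, 7, 4]⟩, ⟨41, 41, 1, [0, 3, 5, 7]⟩, ⟨110, 44, 3,
      [3, 7, 2, 5, 1, 6]⟩, ⟨123, 64, 6, [1, 0, 7, 4, 5, 6, 3]⟩, ⟨95, 66, 5, [0, 4, 7, 3, 2, 1,
      6]⟩, ⟨126, 66, 5, [5, 4, 7, 3, 2, 6, 1]⟩, ⟨79, 69, 3, [0, 3, 1, 6, 7, 2]⟩, ⟨123, 66, 7, [3,
      4, 7, 0, 1, 5, 6]⟩, ⟨109, 72, 3, [0, 6, 7, 3, 5, 2]⟩, ⟨73, 73, 1, [0, 3, 6, 7]⟩, ⟨74, 74, 1,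
      [1, 3, 6, 7]⟩, ⟨121, 81, 3, [0, 7, 4, 6, 3, 5]⟩, ⟨121, 88, 3, [3, 7, 4, 6, 0, 5]⟩, ⟨111, 99,
      10, [3, 7, 2, 1, 0, 6, 5]⟩, ⟨37, 37, 1, [0, 2, 5, 7]⟩, ⟨63, 40, 5, [2, 1, 7, 0, 4, 3, 5]⟩,
      ⟨111, 108, 9, [0, 7, 1, 2, 6, 5, 3]⟩, ⟨61, 52, 3, [2, 0, 3, 5, 7, 4]⟩, ⟨123, 120, 9, [1, 7,
      0, 4, 5, 6, 3]⟩]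
    pairHints := [⟨13416, 0, 0, [5, 3, 6, 7, 8]⟩, ⟨1419, 0, 0, [0, 3, 1, 7, 8]⟩, ⟨4515, 0, 0, [0,
      5, 1, 7, 8]⟩, ⟨10449, 0, 0, [0, 6, 4, 7, 8]⟩, ⟨12126, 8972, 8, [8, 3, 4, 7, 1, 2, 6]⟩,
      ⟨13803, 8586, 11, [6, 5, 7, 0, 1, 8, 3]⟩, ⟨13803, 12554, 9, [5, 6, 7, 0, 8, 3, 1]⟩, ⟨8385,
      8385, 1, [0, 6, 7, 8]⟩, ⟨8514, 8514, 1, [1, 6, 7, 8]⟩, ⟨4902, 0, 0, [1, 5, 2, 7, 8]⟩, ⟨7869,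
      6296, 8, [8, 2, 3, 4, 0, 7, 5]⟩, ⟨13803, 12425, 9, [5, 6, 7, 1, 8, 3, 0]⟩, ⟨4386, 4386, 1,
      [1, 5, 7, 8]⟩, ⟨8901, 0, 0, [2, 0, 6, 7, 8]⟩, ⟨13803, 5155, 9, [0, 1, 8, 6, 7, 3, 5]⟩] },
  { graph := [0, 0, 0, 7, 15]
    block := none
    classes := [([3], [7]), ([0, 1, 2], [24]), ([4], [0, 1, 2, 4, 8, 10]), ([], [16, 18]), ([],
      [11, 13, 14, 15, 19, 21, 22, 23]), ([], [3, 5, 9, 17]), ([], [6, 12, 20])]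
    typeHints := [⟨25, 25, 1, [0, 3, 4, 5]⟩, ⟨26, 26, 1, [1, 3, 4, 5]⟩, ⟨28, 28, 1, [2, 3, 4, 5]⟩]
    pairHints := [⟨1023, 231, 13, [0, 1, 2, 3, 5, 4, 6]⟩, ⟨792, 792, 1, [3, 4, 5, 6]⟩, ⟨693, 0, 0,
      [0, 4, 2, 5, 6]⟩, ⟨858, 0, 4, [1, 5, 3, 6, 4]⟩, ⟨924, 0, 4, [2, 5, 3, 6, 4]⟩, ⟨726, 0, 0,
      [1, 4, 2, 5, 6]⟩, ⟨1023, 321, 5, [6, 0, 2, 1, 5, 4, 3]⟩, ⟨825, 0, 4, [0, 5, 3, 6, 4]⟩, ⟨627,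
      0, 0, [0, 4, 1, 5, 6]⟩, ⟨1023, 324, 5, [6, 2, 0, 1, 5, 4, 3]⟩, ⟨429, 0, 0, [0, 3, 2, 5, 6]⟩,
      ⟨297, 297, 1, [0, 3, 5, 6]⟩, ⟨330, 330, 1, [1, 3, 5, 6]⟩, ⟨1023, 619, 10, [0, 1, 2, 5, 4, 6,
      3]⟩, ⟨1023, 683, 11, [0, 1, 2, 5, 4, 6, 3]⟩, ⟨1023, 715, 11, [1, 0, 2, 5, 4, 6, 3]⟩, ⟨1023,
      747, 12, [0, 1, 2, 5, 4, 3, 6]⟩, ⟨396, 396, 1, [2, 3, 5, 6]⟩, ⟨1023, 621, 11, [0, 1, 2, 6,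
      3, 5, 4]⟩, ⟨1023, 685, 10, [0, 2, 1, 5, 4, 6, 3]⟩, ⟨1023, 717, 11, [2, 0, 1, 5, 4, 6, 3]⟩,
      ⟨1023, 749, 12, [0, 2, 1, 5, 4, 3, 6]⟩, ⟨1023, 622, 11, [1, 0, 2, 6, 3, 5, 4]⟩, ⟨1023, 686,
      11, [2, 0, 1, 6, 3, 5, 4]⟩, ⟨1023, 718, 10, [1, 2, 0, 5, 4, 6, 3]⟩, ⟨1023, 750, 12, [1, 2,
      0, 5, 4, 3, 6]⟩, ⟨1023, 623, 12, [0, 1, 2, 6, 3, 4, 5]⟩, ⟨1023, 687, 12, [0, 2, 1, 6, 3, 4,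
      5]⟩, ⟨1023, 719, 12, [1, 2, 0, 6, 3, 4, 5]⟩, ⟨1023, 751, 14, [0, 1, 2, 3, 6, 4, 5]⟩, ⟨561,
      561, 1, [0, 4, 5, 6]⟩, ⟨594, 594, 1, [1, 4, 5, 6]⟩, ⟨660, 660, 1, [2, 4, 5, 6]⟩, ⟨1023, 163,
      8, [0, 1, 2, 5, 3, 6, 4]⟩, ⟨957, 289, 3, [0, 4, 2, 3, 6, 5]⟩, ⟨957, 545, 3, [0, 3, 2, 4, 6,
      5]⟩, ⟨891, 289, 3, [0, 4, 1, 3, 6, 5]⟩, ⟨891, 545, 3, [0, 3, 1, 4, 6, 5]⟩, ⟨1023, 553, 7,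
      [0, 1, 2, 5, 4, 6, 3]⟩, ⟨957, 388, 3, [2, 4, 0, 3, 6, 5]⟩, ⟨957, 644, 3, [2, 3, 0, 4, 6,
      5]⟩, ⟨1023, 652, 7, [2, 0, 1, 5, 4, 6, 3]⟩] },
  { graph := [0, 0, 1, 3, 11]
    block := some (3, 4, some 0)
    classes := [([4], [9, 11, 12, 15]), ([3], [17, 19, 20, 23]), ([0], [2, 6, 14, 22]), ([1], [0,
      8]), ([], [10, 16, 18])]
    typeHints := [⟨30, 4, 4, [1, 2, 3, 5, 4]⟩, ⟨31, 13, 3, [0, 4, 1, 3, 5, 2]⟩, ⟨31, 21, 3, [0, 3,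
      1, 4, 5, 2]⟩, ⟨27, 24, 16, [0, 1, 5, 3, 4]⟩, ⟨25, 25, 1, [0, 3, 4, 5]⟩, ⟨26, 26, 1, [1, 3,
      4, 5]⟩]
    pairHints := [⟨297, 297, 1, [0, 3, 5, 6]⟩, ⟨726, 128, 0, [2, 6, 5, 1, 4]⟩, ⟨363, 267, 16, [0,
      1, 6, 3, 5]⟩, ⟨627, 0, 0, [0, 4, 1, 5, 6]⟩, ⟨990, 460, 3, [3, 5, 2, 6, 1, 4]⟩, ⟨561, 561, 1,
      [0, 4, 5, 6]⟩, ⟨462, 128, 0, [2, 6, 5, 1, 3]⟩, ⟨627, 531, 16, [0, 1, 6, 4, 5]⟩, ⟨363, 0, 0,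
      [0, 3, 1, 5, 6]⟩, ⟨990, 724, 3, [4, 5, 2, 6, 1, 3]⟩, ⟨231, 66, 4, [1, 0, 5, 2, 6]⟩, ⟨825, 0,
      4, [0, 5, 3, 6, 4]⟩, ⟨891, 322, 3, [1, 4, 0, 3, 6, 5]⟩, ⟨891, 578, 3, [1, 3, 0, 4, 6, 5]⟩,
      ⟨330, 330, 1, [1, 3, 5, 6]⟩, ⟨1023, 718, 15, [3, 6, 0, 1, 2, 4, 5]⟩, ⟨594, 594, 1, [1, 4, 5,
      6]⟩, ⟨231, 2, 0, [1, 5, 6, 0, 2]⟩, ⟨231, 64, 0, [1, 6, 5, 0, 2]⟩] },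
  { graph := [0, 0, 1, 3, 15]
    block := none
    classes := [([1, 2], [0, 9]), ([3], [3, 18]), ([4], [7, 15]), ([0], [12, 20]), ([], [14, 22]),
      ([], [16])]
    typeHints := [⟨27, 1, 17, [0, 1, 5, 3, 4]⟩, ⟨27, 2, 17, [1, 0, 5, 3, 4]⟩, ⟨29, 4, 17, [2, 3,
      5, 0, 4]⟩, ⟨29, 8, 17, [3, 2, 5, 0, 4]⟩, ⟨15, 11, 17, [0, 1, 2, 3, 5]⟩, ⟨15, 13, 17, [3, 2,
      1, 0, 5]⟩, ⟨29, 17, 16, [2, 3, 5, 0, 4]⟩, ⟨21, 21, 1, [0, 2, 4, 5]⟩, ⟨27, 24, 16, [0, 1, 5,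
      3, 4]⟩, ⟨25, 25, 1, [0, 3, 4, 5]⟩, ⟨26, 26, 1, [1, 3, 4, 5]⟩]
    pairHints := [⟨363, 0, 0, [0, 3, 1, 5, 6]⟩, ⟨726, 0, 0, [1, 4, 2, 5, 6]⟩, ⟨924, 0, 0, [2, 4,
      3, 5, 6]⟩, ⟨726, 578, 17, [4, 5, 2, 1, 6]⟩, ⟨594, 594, 1, [1, 4, 5, 6]⟩, ⟨165, 165, 1, [0,
      2, 5, 6]⟩, ⟨627, 0, 0, [0, 4, 1, 5, 6]⟩, ⟨726, 644, 17, [4, 5, 1, 2, 6]⟩, ⟨231, 198, 17, [2,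
      1, 0, 5, 6]⟩] },
  { graph := [0, 0, 0, 0, 1, 2]
    block := some (0, 4, none)
    classes := [([0], [18, 22, 26, 30, 50, 54, 58, 62]), ([4], [3, 7, 11, 15, 35, 39, 43, 47]),
      ([], [19, 23, 27, 31, 33, 37, 41, 45, 49, 51, 53, 55, 57, 59, 61, 63]), ([], [48, 52, 56,
      60])]
    typeHints := [⟨51, 1, 0, [4, 0, 6, 1, 5]⟩, ⟨51, 16, 0, [0, 4, 6, 1, 5]⟩, ⟨51, 17, 4, [0, 1, 4,
      5, 6]⟩]
    pairHints := [⟨1235, 1170, 17, [4, 1, 0, 6, 7]⟩, ⟨1235, 195, 17, [0, 1, 4, 6, 7]⟩, ⟨1105,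
      1105, 1, [0, 4, 6, 7]⟩, ⟨3185, 2129, 17, [7, 4, 5, 0, 6]⟩, ⟨2275, 2145, 17, [5, 0, 1, 6,
      7]⟩, ⟨3185, 3169, 18, [0, 5, 4, 6, 7]⟩, ⟨3185, 3120, 17, [4, 5, 0, 6, 7]⟩] },
  { graph := [0, 0, 0, 0, 1, 19]
    block := none
    classes := [([1, 2, 3, 4], [0, 32, 33]), ([5], [1, 3, 7, 11, 19]), ([0], [16, 18, 22, 26,
      48])]
    typeHints := [⟨31, 2, 19, [0, 1, 2, 3, 4, 6]⟩, ⟨39, 4, 0, [0, 5, 1, 2, 6]⟩, ⟨54, 4, 0, [1, 5,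
      4, 2, 6]⟩, ⟨23, 6, 0, [1, 6, 2, 0, 4]⟩, ⟨43, 8, 0, [0, 5, 1, 3, 6]⟩, ⟨58, 8, 0, [1, 5, 4, 3,
      6]⟩, ⟨27, 10, 0, [1, 6, 3, 0, 4]⟩, ⟨60, 12, 0, [2, 6, 3, 4, 5]⟩, ⟨51, 17, 17, [5, 6, 1, 0,
      4]⟩, ⟨53, 21, 17, [6, 5, 2, 0, 4]⟩, ⟨57, 25, 17, [6, 5, 3, 0, 4]⟩, ⟨45, 12, 0, [2, 6, 3, 0,
      5]⟩, ⟨51, 35, 18, [0, 1, 4, 6, 5]⟩, ⟨31, 4, 19, [0, 2, 1, 3, 4, 6]⟩, ⟨53, 37, 17, [6, 4, 2,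
      0, 5]⟩, ⟨31, 8, 19, [0, 3, 1, 2, 4, 6]⟩, ⟨57, 41, 17, [6, 4, 3, 0, 5]⟩, ⟨29, 12, 0, [2, 6,
      3, 0, 4]⟩, ⟨49, 49, 1, [0, 4, 5, 6]⟩, ⟨51, 50, 18, [4, 1, 0, 6, 5]⟩, ⟨53, 52, 17, [6, 0, 2,
      4, 5]⟩, ⟨57, 56, 17, [6, 0, 3, 4, 5]⟩]
    pairHints := [⟨2925, 0, 19, [0, 6, 2, 3, 5, 7]⟩, ⟨1495, 0, 19, [0, 6, 1, 2, 4, 7]⟩, ⟨3185,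
      2112, 17, [7, 4, 6, 0, 5]⟩, ⟨3185, 2144, 18, [0, 6, 4, 7, 5]⟩, ⟨2145, 2145, 1, [0, 5, 6,
      7]⟩, ⟨3900, 0, 19, [4, 6, 2, 3, 5, 7]⟩, ⟨3380, 256, 0, [2, 7, 6, 4, 5]⟩, ⟨3640, 512, 0, [3,
      7, 6, 4, 5]⟩, ⟨3185, 1089, 18, [4, 6, 5, 7, 0]⟩, ⟨1235, 195, 17, [0, 1, 4, 6, 7]⟩, ⟨1105,
      1105, 1, [0, 4, 6, 7]⟩, ⟨2405, 256, 0, [2, 7, 6, 0, 5]⟩, ⟨2665, 512, 0, [3, 7, 6, 0, 5]⟩,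
      ⟨3185, 3088, 18, [5, 6, 0, 7, 4]⟩, ⟨1235, 1170, 17, [4, 1, 0, 6, 7]⟩, ⟨3120, 3120, 1, [4, 5,
      6, 7]⟩] },
  { graph := [0, 0, 0, 1]
    block := none
    classes := [([1, 2, 3], [1]), ([0], [8]), ([], [0, 2, 4]), ([], [3, 7, 9, 11, 13, 15]), ([],
      [5]), ([], [10, 14]), ([], [12])]
    typeHints := [⟨15, 6, 0, [1, 4, 2, 0, 3]⟩]
    pairHints := [⟨255, 17, 20, [4, 3, 1, 2, 5, 0]⟩, ⟨255, 136, 20, [4, 0, 1, 2, 5, 3]⟩, ⟨255, 0,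
      19, [0, 4, 1, 2, 3, 5]⟩, ⟨187, 32, 0, [1, 5, 4, 0, 3]⟩, ⟨221, 64, 0, [2, 5, 4, 0, 3]⟩, ⟨187,
      34, 4, [1, 0, 4, 3, 5]⟩, ⟨221, 68, 4, [2, 0, 4, 3, 5]⟩, ⟨187, 51, 17, [0, 1, 3, 4, 5]⟩,
      ⟨187, 147, 17, [4, 3, 1, 0, 5]⟩, ⟨187, 179, 18, [0, 1, 3, 4, 5]⟩, ⟨153, 153, 1, [0, 3, 4,
      5]⟩, ⟨221, 85, 17, [0, 2, 3, 4, 5]⟩, ⟨187, 170, 17, [3, 1, 0, 4, 5]⟩, ⟨221, 204, 17, [3, 2,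
      0, 4, 5]⟩] },
  { graph := [0, 0, 0, 3]
    block := none
    classes := [([2, 3], [3]), ([0, 1], [8]), ([], [5, 7, 11, 13, 15]), ([], [6, 14])]
    typeHints := [⟨13, 0, 21, [0, 2, 4, 3]⟩, ⟨7, 1, 21, [0, 1, 2, 4]⟩, ⟨7, 4, 21, [2, 0, 1, 4]⟩,
      ⟨7, 2, 21, [1, 0, 2, 4]⟩]
    pairHints := [⟨204, 0, 21, [4, 2, 3, 5]⟩, ⟨51, 0, 21, [4, 0, 1, 5]⟩, ⟨221, 85, 17, [0, 2, 3,
      4, 5]⟩, ⟨221, 149, 17, [4, 3, 2, 0, 5]⟩, ⟨221, 213, 18, [0, 2, 3, 4, 5]⟩, ⟨153, 153, 1, [0,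
      3, 4, 5]⟩, ⟨221, 68, 4, [2, 0, 4, 3, 5]⟩, ⟨187, 162, 17, [3, 4, 0, 1, 5]⟩, ⟨170, 170, 1, [1,
      3, 4, 5]⟩] },
  { graph := [0, 0, 1, 5]
    block := none
    classes := [([0, 1], []), ([2], [3, 10]), ([3], [6])]
    typeHints := [⟨7, 0, 21, [0, 1, 4, 2]⟩, ⟨7, 1, 22, [2, 4, 1, 0]⟩, ⟨15, 2, 4, [0, 1, 2, 4, 3]⟩,
      ⟨7, 4, 22, [0, 4, 1, 2]⟩, ⟨11, 1, 22, [3, 4, 1, 0]⟩, ⟨15, 7, 17, [4, 3, 1, 0, 2]⟩, ⟨15, 11,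
      17, [4, 2, 1, 0, 3]⟩, ⟨13, 13, 1, [0, 2, 3, 4]⟩, ⟨15, 14, 17, [4, 0, 1, 2, 3]⟩]
    pairHints := [⟨238, 34, 4, [1, 2, 4, 3, 5]⟩, ⟨255, 163, 2, [0, 4, 1, 5, 3, 2]⟩, ⟨119, 34, 4,
      [1, 0, 4, 2, 5]⟩, ⟨187, 34, 4, [1, 0, 4, 3, 5]⟩] }]

theorem checkAll_certificates : Certificate.checkAll forbidden certificates = true := by
  decide +kernel

theorem not_has_of_not_contains {n : ℕ} {H : SimpleGraph (Fin n)} {g : List ℕ} {G : SimpleGraph V}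
    (hn : g.length = n) (hH : ∀ i j : Fin n, H.Adj i j ↔ adj g i j = true)
    (h : ¬ Contains G H) : ¬ Has G g := by
  rintro ⟨f, hf⟩
  subst hn
  refine h ⟨⟨⟨fun i => f i, fun i j hij => ?_⟩, fun {i j} => ?_⟩⟩
  · by_contra hne
    exact hf.ne i.2 j.2 (Fin.val_ne_of_ne hne) hij
  · rw [hH]
    exact hf.adj_iff i.2 j.2

theorem not_has_forbidden {G : SimpleGraph V} (hP : ¬ Contains G P3P2)
    (hK : ¬ Contains G (completeGraph (Fin 4))) (hD : ¬ Contains G coDomino)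
    (hA : ¬ Contains G coA) : ∀ p ∈ forbidden, ¬ Has G p := by
  simp only [forbidden, List.forall_mem_cons]
  refine ⟨not_has_of_not_contains rfl ?_ hP, not_has_of_not_contains rfl ?_ hK,
    not_has_of_not_contains rfl ?_ hD, not_has_of_not_contains rfl ?_ hA, by simp⟩
  · simp only [P3P2, fromEdgeSet_adj, Set.mem_insert_iff, Set.mem_singleton_iff]
    decide
  · simp only [completeGraph, top_adj]
    decide
  · simp only [coDomino, fromEdgeSet_adj, Set.mem_insert_iff, Set.mem_singleton_iff]
    decide
  · simp only [coA, fromEdgeSet_adj, Set.mem_insert_iff, Set.mem_singleton_iff]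
    decide

/-- The graph `K₃ ∪ K₁`. -/
abbrev triangleAndPoint : List ℕ := [0, 0, 1, 5]

theorem has_triangleAndPoint [Finite V] {G : SimpleGraph V} {x : V} (hx : x ∉ D1 G) :
    Has G triangleAndPoint := by
  classical
  obtain ⟨s, hs⟩ := (G.induce {y : V | ¬ G.Adj x y}).exists_isNClique_cliqueNum
  have hx : 2 < s.card := hs.card_eq ▸ not_le.1 hx
  obtain ⟨t, hts, ht⟩ := Finset.exists_subset_card_eq (Nat.succ_le_of_lt hx)
  obtain ⟨⟨a, ha⟩, ⟨b, hb⟩, ⟨c, hc⟩, hab, hac, hbc, -⟩ :=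
    is3Clique_iff.1 ⟨hs.isClique.subset hts, ht⟩
  simp only [comap_adj, Function.Embedding.subtype_apply] at hab hac hbc
  simp only [Set.mem_ofPred_eq] at ha hb hc
  refine ⟨fun i => [a, x, b, c].getD i a, fun i hi j hj => ?_⟩
  simp only [triangleAndPoint, List.length_cons, List.length_nil] at hi
  have := G.adj_comm
  have := fun x y (h : G.Adj x y) => h.ne
  interval_cases i <;> interval_cases j <;> simp [Nat.testBit] <;> grind

end RowGraph

theorem chromatic_le_seven_of_D2_not_clique {V : Type*} [Fintype V] (G : SimpleGraph V)
    (hP : ¬ Contains G P3P2) (hK : ¬ Contains G (completeGraph (Fin 4)))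
    (hD : ¬ Contains G coDomino) (hA : ¬ Contains G coA)
    (hclique : ¬ G.IsClique ((D1 G)ᶜ)) :
    G.chromaticNumber ≤ 7 := by
  obtain ⟨x, hx⟩ : ∃ x, x ∉ D1 G := by
    by_contra! h
    exact hclique fun x hx => absurd (h x) hx
  have hfree := RowGraph.not_has_forbidden hP hK hD hA
  by_contra hχ
  have hcol : ¬ G.Colorable 7 := fun h => hχ h.chromaticNumber_le
  refine RowGraph.Certificate.not_has_of_checkAll (hfree _ ?_)
    (not_not.1 fun h => hK ⟨topEmbeddingOfNotCliqueFree h⟩) hcol hfree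
    RowGraph.checkAll_certificates (RowGraph.certificates.getLast ?_) (List.getLast_mem _)
    (RowGraph.has_triangleAndPoint hx)
  all_goals simp [RowGraph.forbidden, RowGraph.certificates]
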